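/- Let (PA_t)_{t≥1} be a preferential attachment model with m ≥ 2 and δ ∈ (−m, 0). Then for every k ∈ ℕ, the number M_k of minimally-k-connected vertices satisfies E[M_k^2] ≤ exp(32 m i_k^2/t) · E[M_k]^2 + E[M_k], where i_k = (m^{k+1} − 1)/(m − 1). Consequently, for k = k_t^− = (1−ε) log log t/log m with ε > 0 fixed, E[M_{k_t^−}^2] ≤ (1 + o(1)) E[M_{k_t^−}]^2 as t → ∞. -/

import Mathlib

open Finset Filter

open scoped Classical

noncomputable section

/-- A realization of the attachment choices of the preferential attachment model of
size `t` with `m` edges per vertex: `ξ s j` is the vertex (0-based; vertex `v : Fin t`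
represents the 1-based vertex `v.val + 1 ∈ [t]`) to which the `(j+1)`-st edge of
vertex `s.val + 1` is attached. -/
abbrev PAConfig (t m : ℕ) : Type := Fin t → Fin m → Fin t

/-- The degree `D_{s,j}(v)` of the 1-based vertex `v` after the first `j` edges of the
1-based vertex `s` have been attached (a self-loop contributes 2 to the degree). -/
def paDeg {t m : ℕ} (ξ : PAConfig t m) (s j v : ℕ) : ℕ :=
  ∑ ui : Fin t × Fin m,
    if ui.1.val + 1 < s ∨ (ui.1.val + 1 = s ∧ ui.2.val + 1 ≤ j) then
      (if (ξ ui.1 ui.2).val + 1 = v then 1 else 0) + (if ui.1.val + 1 = v then 1 else 0)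
    else 0

/-- The normalizing constant `c_{s,j} = [m(s-1)+(j-1)](2+δ/m) + 1 + δ/m`
(`s`, `j` 1-based). -/
def paC (m : ℕ) (δ : ℝ) (s j : ℕ) : ℝ :=
  ((m : ℝ) * ((s : ℝ) - 1) + ((j : ℝ) - 1)) * (2 + δ / m) + 1 + δ / m

/-- The probability of the realization `ξ` of the preferential attachment model
`PA_t(m, δ)`: the product over all edges of the conditional attachment probabilities
`(D_{s,j-1}(v) + 1 + jδ/m)/c_{s,j}` (self-loop) resp. `(D_{s,j-1}(v) + δ)/c_{s,j}`
(attachment to an older vertex `v < s`). -/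
def paWeight (t m : ℕ) (δ : ℝ) (ξ : PAConfig t m) : ℝ :=
  ∏ s : Fin t, ∏ j : Fin m,
    if (ξ s j).val = s.val then
      ((paDeg ξ (s.val + 1) j.val (s.val + 1) : ℝ) + 1 + ((j.val : ℝ) + 1) * δ / m) /
        paC m δ (s.val + 1) (j.val + 1)
    else if (ξ s j).val < s.val then
      ((paDeg ξ (s.val + 1) j.val ((ξ s j).val + 1) : ℝ) + δ) /
        paC m δ (s.val + 1) (j.val + 1)
    else 0

/-- The probability of an event under the preferential attachment model `PA_t(m, δ)`. -/
def paProb (t m : ℕ) (δ : ℝ) (E : PAConfig t m → Prop) : ℝ :=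
  ∑ ξ ∈ (univ : Finset (PAConfig t m)).filter E, paWeight t m δ ξ

/-- The expectation of a random variable under `PA_t(m, δ)`. -/
def paExp (t m : ℕ) (δ : ℝ) (f : PAConfig t m → ℝ) : ℝ :=
  ∑ ξ : PAConfig t m, paWeight t m δ ξ * f ξ

/-- Adjacency in the graph `PA_t`. -/
def paAdj {t m : ℕ} (ξ : PAConfig t m) (u v : Fin t) : Prop :=
  ∃ j : Fin m, ξ u j = v ∨ ξ v j = u

/-- The degree `D_t(v)` of the vertex `v` at time `t`, i.e. in the graph `PA_t`. -/
def paDegT {t m : ℕ} (ξ : PAConfig t m) (v : Fin t) : ℕ := paDeg ξ t m (v.val + 1)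

/-- There is a walk of length `k` from `u` to `v` in the graph with adjacency relation `A`. -/
def reachIn {V : Type*} (A : V → V → Prop) (u v : V) (k : ℕ) : Prop :=
  ∃ p : ℕ → V, p 0 = u ∧ p k = v ∧ ∀ i < k, A (p i) (p (i + 1))

/-- Graph distance (`⊤` if there is no path). -/
def graphDist {V : Type*} (A : V → V → Prop) (u v : V) : ℕ∞ :=
  ⨅ (k : ℕ) (_ : reachIn A u v k), (k : ℕ∞)

/-- Graph diameter: the maximal graph distance between pairs of vertices. -/
def graphDiam {V : Type*} (A : V → V → Prop) : ℕ∞ :=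
  ⨆ (u : V) (v : V), graphDist A u v

/-- The `k`-neighbourhood `U_{≤k}(v)` of `v` in `PA_t`. -/
def paBallF {t m : ℕ} (ξ : PAConfig t m) (v : Fin t) (k : ℕ) : Finset (Fin t) :=
  univ.filter (fun u => graphDist (paAdj ξ) v u ≤ (k : ℕ∞))

/-- `i_k = 1 + ∑_{i=1}^k m^i = (m^{k+1} - 1)/(m - 1)`, the number of vertices of the
tree of a minimally-`k`-connected vertex. -/
def paik (m k : ℕ) : ℕ := ∑ l ∈ Finset.range (k + 1), m ^ l

/-- `v ∈ [t] \ [t/2]` is minimally-`k`-connected: `D_t(v) = m`, every other vertex of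
`U_{≤k}(v)` lies in `[t/2] \ [t/4]` and has degree `m + 1` at time `t`, and `U_{≤k}(v)`
contains no self-loops, multiple edges or cycles (equivalently, it has exactly `i_k`
vertices and `i_k - 1` internal edges, hence is a tree). -/
def paMinConn {t m : ℕ} (ξ : PAConfig t m) (v : Fin t) (k : ℕ) : Prop :=
  t / 2 ≤ v.val ∧ paDegT ξ v = m ∧
  (∀ u ∈ paBallF ξ v k, u ≠ v → (t / 4 ≤ u.val ∧ u.val < t / 2) ∧ paDegT ξ u = m + 1) ∧
  (paBallF ξ v k).card = paik m k ∧
  ((univ : Finset (Fin t × Fin m)).filter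
      (fun uj => uj.1 ∈ paBallF ξ v k ∧ ξ uj.1 uj.2 ∈ paBallF ξ v k)).card =
    paik m k - 1

/-- `M_k`: the number of minimally-`k`-connected vertices of `PA_t`. -/
def paMk {t m : ℕ} (ξ : PAConfig t m) (k : ℕ) : ℕ :=
  ((univ : Finset (Fin t)).filter (fun v => paMinConn ξ v k)).card

/-- `k_t^- = (1 - ε) log log t / log m`, rounded to the nearest integer. -/
def ktMinus (ε : ℝ) (m t : ℕ) : ℕ :=
  (round ((1 - ε) * Real.log (Real.log t) / Real.log m)).toNat

section Sequential

/-- Total mass of a sequentially built product measure on a product of constraint sets: if, given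
any admissible past, the admissible mass of coordinate `i` is `g i`, the total mass is `∏ g i`. -/
theorem sum_piFinset_prod_of_sequential {ι α κ : Type*} [Fintype ι] [DecidableEq ι] [LinearOrder κ]
    (r : ι → κ) (hr : Function.Injective r) (S : ι → Finset α) (hS : ∀ i, (S i).Nonempty)
    (p : ι → (ι → α) → ℝ) (g : ι → ℝ)
    (hloc : ∀ i ξ j a, r i < r j → p i (Function.update ξ j a) = p i ξ)
    (hg : ∀ i ξ, (∀ j, r j < r i → ξ j ∈ S j) →
      ∑ a ∈ S i, p i (Function.update ξ i a) = g i) :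
    ∑ ξ ∈ Fintype.piFinset S, ∏ i, p i ξ = ∏ i, g i := by
  choose a₀ ha₀ using hS
  suffices H : ∀ F : Finset ι,
      ∑ ξ ∈ Fintype.piFinset (fun i => if i ∈ F then S i else {a₀ i}), ∏ i ∈ F, p i ξ =
        ∏ i ∈ F, g i by
    simpa using H univ
  intro F
  induction F using Finset.induction_on_max_value r with
  | empty =>
    rw [Finset.sum_eq_card_nsmul (b := 1) (by simp)]
    simp
  | insert i F hi hmax ih =>
    have hlt : ∀ j ∈ F, r j < r i := fun j hj =>
      lt_of_le_of_ne (hmax j hj) fun h => hi (hr h ▸ hj)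
    rw [Finset.prod_insert hi, ← ih, Finset.mul_sum]
    have key : ∑ ξ ∈ Fintype.piFinset (fun j => if j ∈ insert i F then S j else {a₀ j}),
        ∏ j ∈ insert i F, p j ξ =
        ∑ q ∈ Fintype.piFinset (fun j => if j ∈ F then S j else {a₀ j}) ×ˢ S i,
          (∏ j ∈ F, p j q.1) * p i (Function.update q.1 i q.2) := by
      refine Finset.sum_nbij' (fun ξ => (Function.update ξ i (a₀ i), ξ i))
        (fun q => Function.update q.1 i q.2) ?_ ?_ ?_ ?_ ?_
      · intro ξ hξ
        rw [Fintype.mem_piFinset] at hξ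
        rw [Finset.mem_product, Fintype.mem_piFinset]
        refine ⟨fun j => ?_, by simpa using hξ i⟩
        by_cases hj : j = i
        · subst hj; simp [hi]
        · simpa [hj] using hξ j
      · rintro ⟨ξ, a⟩ hq
        rw [Finset.mem_product, Fintype.mem_piFinset] at hq
        rw [Fintype.mem_piFinset]
        intro j
        by_cases hj : j = i
        · subst hj; simpa using hq.2
        · simpa [hj] using hq.1 j
      · intro ξ _; simp
      · rintro ⟨ξ, a⟩ hq
        rw [Finset.mem_product, Fintype.mem_piFinset] at hq
        have h1 : ξ i = a₀ i := by simpa [hi] using hq.1 i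
        simp [← h1]
      · intro ξ _
        rw [Finset.prod_insert hi, mul_comm]
        congr 1
        · exact Finset.prod_congr rfl fun j hj => (hloc j ξ i _ (hlt j hj)).symm
        · simp
    rw [key, Finset.sum_product]
    refine Finset.sum_congr rfl fun ξ hξ => ?_
    dsimp only
    rw [← Finset.mul_sum, hg i ξ, mul_comm]
    intro j _
    have := (Fintype.mem_piFinset.1 hξ) j
    split_ifs at this with h
    · exact this
    · rw [Finset.mem_singleton] at this
      rw [this]; exact ha₀ j

end Sequential

section Model

variable {t m : ℕ}

theorem card_filter_fin_lt {n : ℕ} (a : Fin n) :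
    (univ.filter fun x : Fin n => x < a).card = a.val := by
  have h : (univ.filter fun x : Fin n => x < a) = Finset.Iio a := by ext; simp
  rw [h, Fin.card_Iio]

/-- The edge `u` is attached before the edge `e`. -/
def edgeBefore (u e : Fin t × Fin m) : Prop := u.1 < e.1 ∨ (u.1 = e.1 ∧ u.2 < e.2)

theorem edgeBefore_iff_toLex (u e : Fin t × Fin m) : edgeBefore u e ↔ toLex u < toLex e := by
  rw [Prod.Lex.toLex_lt_toLex]; rfl

/-- The edges attached to `v` before `e`. -/
def inBefore (ξ : PAConfig t m) (e : Fin t × Fin m) (v : Fin t) : Finset (Fin t × Fin m) :=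
  univ.filter fun u => edgeBefore u e ∧ ξ u.1 u.2 = v

/-- The number of edges issued by `v` before `e`. -/
def outBefore (e : Fin t × Fin m) (v : Fin t) : ℕ :=
  if v < e.1 then m else if v = e.1 then e.2.val else 0

theorem card_filter_edgeBefore_fst (e : Fin t × Fin m) (v : Fin t) :
    (univ.filter fun u : Fin t × Fin m => edgeBefore u e ∧ u.1 = v).card = outBefore e v := by
  have h : (univ.filter fun u : Fin t × Fin m => edgeBefore u e ∧ u.1 = v) =
      (univ.filter fun j : Fin m => v < e.1 ∨ (v = e.1 ∧ j < e.2)).image (fun j => (v, j)) := by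
    ext ⟨a, b⟩
    rw [mem_filter, Finset.mem_image]
    constructor
    · rintro ⟨-, h, rfl⟩; exact ⟨b, mem_filter.2 ⟨mem_univ _, h⟩, rfl⟩
    · rintro ⟨j, h, h'⟩
      obtain ⟨rfl, rfl⟩ := Prod.mk.inj h'
      exact ⟨mem_univ _, (mem_filter.1 h).2, rfl⟩
  rw [h, Finset.card_image_of_injective _ fun a b h => (Prod.mk.inj h).2]
  unfold outBefore
  split_ifs with h1 h2
  · simp [h1]
  · simp [h2, card_filter_fin_lt]
  · simp [h1, h2]

theorem paDeg_eq (ξ : PAConfig t m) (e : Fin t × Fin m) (v : Fin t) :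
    paDeg ξ (e.1.val + 1) e.2.val (v.val + 1) = (inBefore ξ e v).card + outBefore e v := by
  rw [← card_filter_edgeBefore_fst, inBefore, Finset.card_filter, Finset.card_filter,
    ← Finset.sum_add_distrib, paDeg]
  refine Finset.sum_congr rfl fun u _ => ?_
  have hb : (u.1.val + 1 < e.1.val + 1 ∨ (u.1.val + 1 = e.1.val + 1 ∧ u.2.val + 1 ≤ e.2.val)) ↔
      edgeBefore u e := by
    simp only [edgeBefore, Fin.lt_def, Fin.ext_iff]; omega
  have h1 : (ξ u.1 u.2).val + 1 = v.val + 1 ↔ ξ u.1 u.2 = v := by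
    simp [Fin.ext_iff]
  have h2 : u.1.val + 1 = v.val + 1 ↔ u.1 = v := by
    simp [Fin.ext_iff]
  simp only [hb, h1, h2]
  by_cases h : edgeBefore u e <;> simp [h]

theorem paDegT_eq (ξ : PAConfig t m) (v : Fin t) :
    paDegT ξ v = (univ.filter fun u : Fin t × Fin m => ξ u.1 u.2 = v).card + m := by
  have hm : m = (univ.filter fun u : Fin t × Fin m => u.1 = v).card := by
    have h : (univ.filter fun u : Fin t × Fin m => u.1 = v) =
        (univ : Finset (Fin m)).image (fun j => (v, j)) := by
      ext ⟨a, b⟩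
      simp [eq_comm]
    rw [h, Finset.card_image_of_injective _ fun a b h => (Prod.mk.inj h).2]
    simp
  refine Eq.trans ?_ (congrArg _ hm.symm)
  rw [Finset.card_filter, Finset.card_filter, ← Finset.sum_add_distrib, paDegT, paDeg]
  refine Finset.sum_congr rfl fun u _ => ?_
  have hb : (u.1.val + 1 < t ∨ (u.1.val + 1 = t ∧ u.2.val + 1 ≤ m)) := by
    have := u.1.isLt; have := u.2.isLt; omega
  rw [if_pos hb]
  simp [Fin.ext_iff]

/-- The unnormalized conditional probability that the edge `e` is attached to `x`. -/
def paNum (δ : ℝ) (ξ : PAConfig t m) (e : Fin t × Fin m) (x : Fin t) : ℝ :=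
  if x = e.1 then (paDeg ξ (e.1.val + 1) e.2.val (e.1.val + 1) : ℝ) + 1 + ((e.2.val : ℝ) + 1) * δ / m
  else if x < e.1 then (paDeg ξ (e.1.val + 1) e.2.val (x.val + 1) : ℝ) + δ
  else 0

/-- The normalizing constant of the edge `e`. -/
def paNorm (δ : ℝ) (e : Fin t × Fin m) : ℝ := paC m δ (e.1.val + 1) (e.2.val + 1)

theorem paWeight_eq_prod (δ : ℝ) (ξ : PAConfig t m) :
    paWeight t m δ ξ = ∏ e : Fin t × Fin m, paNum δ ξ e (ξ e.1 e.2) / paNorm δ e := by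
  rw [paWeight, Fintype.prod_prod_type]
  refine Finset.prod_congr rfl fun s _ => Finset.prod_congr rfl fun j _ => ?_
  simp only [paNum, paNorm, Fin.ext_iff, Fin.lt_def]
  split_ifs <;> simp

theorem paNorm_eq (hm : 0 < m) (δ : ℝ) (e : Fin t × Fin m) :
    paNorm δ e = 2 * ((m : ℝ) * e.1.val + e.2.val) + e.1.val * δ + 1 +
      ((e.2.val : ℝ) + 1) * δ / m := by
  have : (m : ℝ) ≠ 0 := by positivity
  simp only [paNorm, paC]
  push_cast
  field_simp
  ring

theorem paNorm_ge (hm : 0 < m) {δ : ℝ} (hδ : -(m : ℝ) < δ) (e : Fin t × Fin m) :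
    (e.1.val : ℝ) * (2 * m + δ) < paNorm δ e := by
  have hm' : (0 : ℝ) < m := by positivity
  rw [paNorm_eq hm]
  have h1 : -1 < δ / m := by rw [lt_div_iff₀ hm']; linarith
  have h2 : ((e.2.val : ℝ) + 1) * (δ / m) ≥ -((e.2.val : ℝ) + 1) := by nlinarith [e.2.val.cast_nonneg (α := ℝ)]
  have h3 : -1 < 2 * (e.2.val : ℝ) + 1 + ((e.2.val : ℝ) + 1) * δ / m - 1 := by
    have h4 : ((e.2.val : ℝ) + 1) * (δ / m + 1) > 0 := by
      have : (0:ℝ) ≤ e.2.val := by positivity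
      have h5 : 0 < δ / m + 1 := by linarith
      positivity
    rw [mul_div_assoc]
    nlinarith [e.2.val.cast_nonneg (α := ℝ)]
  linarith

theorem paNorm_pos (hm : 0 < m) {δ : ℝ} (hδ : -(m : ℝ) < δ) (e : Fin t × Fin m) :
    0 < paNorm δ e := by
  refine lt_of_le_of_lt ?_ (paNorm_ge hm hδ e)
  have hm' : (0 : ℝ) < m := by positivity
  have : 0 ≤ 2 * (m : ℝ) + δ := by linarith
  positivity

theorem paNum_nonneg (hm : 0 < m) {δ : ℝ} (hδ : -(m : ℝ) < δ) (ξ : PAConfig t m)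
    (e : Fin t × Fin m) (x : Fin t) : 0 ≤ paNum δ ξ e x := by
  have hm' : (0 : ℝ) < m := by positivity
  have h1 : -1 < δ / m := by rw [lt_div_iff₀ hm']; linarith
  unfold paNum
  split_ifs with h h'
  · rw [paDeg_eq, outBefore, mul_div_assoc]
    simp only [lt_irrefl, if_false, if_true]
    push_cast
    have : (0:ℝ) ≤ e.2.val := by positivity
    have h3 : (0:ℝ) ≤ (inBefore ξ e e.1).card := by positivity
    nlinarith
  · rw [paDeg_eq, outBefore, if_pos h']
    push_cast
    have h3 : (0:ℝ) ≤ (inBefore ξ e x).card := by positivity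
    linarith
  · rfl

theorem paWeight_nonneg (hm : 0 < m) {δ : ℝ} (hδ : -(m : ℝ) < δ) (ξ : PAConfig t m) :
    0 ≤ paWeight t m δ ξ := by
  rw [paWeight_eq_prod]
  exact Finset.prod_nonneg fun e _ =>
    div_nonneg (paNum_nonneg hm hδ ξ e _) (paNorm_pos hm hδ e).le

theorem le_of_paWeight_ne_zero {δ : ℝ} {ξ : PAConfig t m} (h : paWeight t m δ ξ ≠ 0)
    (e : Fin t × Fin m) : ξ e.1 e.2 ≤ e.1 := by
  by_contra hlt
  apply h
  rw [paWeight_eq_prod]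
  refine Finset.prod_eq_zero (mem_univ e) ?_
  rw [paNum, if_neg (by rintro h; exact hlt h.le), if_neg (fun h => hlt h.le), zero_div]

theorem inBefore_update (ξ : Fin t × Fin m → Fin t) (i j : Fin t × Fin m) (a v : Fin t)
    (h : ¬ edgeBefore j i) :
    inBefore (Function.curry (Function.update ξ j a)) i v = inBefore (Function.curry ξ) i v := by
  unfold inBefore
  ext u
  rw [mem_filter, mem_filter]
  refine and_congr_right fun _ => and_congr_right fun hu => ?_
  rw [Function.curry_apply, Function.curry_apply, Function.update_of_ne]
  rintro rfl; exact h hu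

theorem paNum_update (δ : ℝ) (ξ : Fin t × Fin m → Fin t) (i j : Fin t × Fin m) (a x : Fin t)
    (h : ¬ edgeBefore j i) :
    paNum δ (Function.curry (Function.update ξ j a)) i x = paNum δ (Function.curry ξ) i x := by
  simp only [paNum, paDeg_eq, inBefore_update ξ i j a _ h]

theorem sum_paNum (hm : 0 < m) (δ : ℝ) (ξ : PAConfig t m) (e : Fin t × Fin m)
    (hξ : ∀ u, edgeBefore u e → ξ u.1 u.2 ≤ u.1) : ∑ x, paNum δ ξ e x = paNorm δ e := by
  have hlt : ∑ x : Fin t, (if x < e.1 then (1 : ℝ) else 0) = e.1.val := by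
    rw [Finset.sum_boole, card_filter_fin_lt]
  have hout : ∑ x : Fin t, (outBefore e x : ℝ) = m * e.1.val + e.2.val := by
    have : ∀ x : Fin t, (outBefore e x : ℝ) = m * (if x < e.1 then (1 : ℝ) else 0) +
        (if x = e.1 then (e.2.val : ℝ) else 0) := by
      intro x
      unfold outBefore
      split_ifs with h1 h2 h2
      · exact absurd h1 (h2 ▸ lt_irrefl _)
      · simp
      · simp
      · simp
    simp only [this]
    rw [Finset.sum_add_distrib, ← Finset.mul_sum, hlt]
    simp
  have hin : ∑ x : Fin t, ((inBefore ξ e x).card : ℝ) = m * e.1.val + e.2.val := by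
    rw [← hout]
    simp only [← card_filter_edgeBefore_fst, inBefore]
    norm_cast
    simp only [Finset.card_filter]
    rw [Finset.sum_comm]
    conv_rhs => rw [Finset.sum_comm]
    refine Finset.sum_congr rfl fun u _ => ?_
    by_cases h : edgeBefore u e <;> simp [h]
  have hnum : ∀ x, paNum δ ξ e x = (inBefore ξ e x).card + outBefore e x +
      δ * (if x < e.1 then (1 : ℝ) else 0) +
      (if x = e.1 then 1 + ((e.2.val : ℝ) + 1) * δ / m else 0) := by
    intro x
    unfold paNum
    split_ifs with h1 h2 h2
    · exact absurd h2 (h1 ▸ lt_irrefl _)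
    · subst h1; rw [paDeg_eq]; push_cast; ring
    · rw [paDeg_eq]; push_cast; ring
    · have hin0 : inBefore ξ e x = ∅ := by
        ext u
        simp only [inBefore, mem_filter, mem_univ, true_and, notMem_empty, iff_false, not_and]
        intro hu hx
        have h3 := hξ u hu
        have h4 : u.1 ≤ e.1 := by
          rcases hu with h | h
          · exact h.le
          · exact h.1.le
        rw [hx] at h3
        exact h2 (lt_of_le_of_ne (h3.trans h4) h1)
      simp [hin0, outBefore, h1, h2]
  simp only [hnum]
  rw [Finset.sum_add_distrib, Finset.sum_add_distrib, Finset.sum_add_distrib, hin, hout,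
    ← Finset.mul_sum, hlt, paNorm_eq hm]
  simp only [Finset.sum_ite_eq', mem_univ, if_true]
  ring

end Model

section Pattern

variable {t m : ℕ}

/-- A prescribed family of edges `R` inside a vertex set `V`: `R e u` requires the edge `e` to be
attached to `u`; no vertex is prescribed as a target twice. -/
structure IsPattern (V : Finset (Fin t)) (R : Fin t × Fin m → Fin t → Prop) : Prop where
  target_mem : ∀ {e u}, R e u → u ∈ V
  source_mem : ∀ {e u}, R e u → e.1 ∈ V
  target_lt : ∀ {e u}, R e u → u < e.1
  functional : ∀ {e u u'}, R e u → R e u' → u = u'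
  injective : ∀ {e e' u}, R e u → R e' u → e = e'
  pos : ∀ u ∈ V, 0 < u.val

/-- The admissible targets of the edge `e`: the prescribed one, or else any older vertex
outside of `V`. -/
def patternTargets (V : Finset (Fin t)) (R : Fin t × Fin m → Fin t → Prop)
    (e : Fin t × Fin m) : Finset (Fin t) :=
  if ∃ u, R e u then univ.filter (R e) else univ.filter fun x => x ≤ e.1 ∧ x ∉ V

/-- The realizations whose edges into `V` are exactly those prescribed by `R`. -/
def patternEvent (V : Finset (Fin t)) (R : Fin t × Fin m → Fin t → Prop) :
    Finset (PAConfig t m) :=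
  univ.filter fun ξ => ∀ e : Fin t × Fin m, ξ e.1 e.2 ∈ patternTargets V R e

/-- The unnormalized probability that `e` is attached to `u ∈ V`, given that the past agrees with
the pattern. -/
def patternNum (δ : ℝ) (R : Fin t × Fin m → Fin t → Prop) (e : Fin t × Fin m) (u : Fin t) : ℝ :=
  if u = e.1 then (e.2.val : ℝ) + 1 + ((e.2.val : ℝ) + 1) * δ / m
  else if u < e.1 then m + δ + (if ∃ e', edgeBefore e' e ∧ R e' u then 1 else 0)
  else 0

/-- The conditional probability that `e` agrees with the pattern, given that the past does. -/
def patternFactor (δ : ℝ) (V : Finset (Fin t)) (R : Fin t × Fin m → Fin t → Prop)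
    (e : Fin t × Fin m) : ℝ :=
  if ∃ u, R e u then (m + δ) / paNorm δ e else 1 - (∑ u ∈ V, patternNum δ R e u) / paNorm δ e

/-- The probability of the event prescribed by a pattern. -/
def patternProb (δ : ℝ) (V : Finset (Fin t)) (R : Fin t × Fin m → Fin t → Prop) : ℝ :=
  ∑ ξ ∈ patternEvent V R, paWeight t m δ ξ

variable {V V' : Finset (Fin t)} {R R' : Fin t × Fin m → Fin t → Prop} {δ : ℝ}

theorem mem_patternEvent {ξ : PAConfig t m} :
    ξ ∈ patternEvent V R ↔ ∀ e : Fin t × Fin m, ξ e.1 e.2 ∈ patternTargets V R e := by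
  simp [patternEvent]

theorem mem_patternTargets_of_exists {e : Fin t × Fin m} {x : Fin t} (h : ∃ u, R e u) :
    x ∈ patternTargets V R e ↔ R e x := by
  rw [patternTargets, if_pos h, mem_filter]; simp

theorem mem_patternTargets_of_not_exists {e : Fin t × Fin m} {x : Fin t} (h : ¬ ∃ u, R e u) :
    x ∈ patternTargets V R e ↔ x ≤ e.1 ∧ x ∉ V := by
  rw [patternTargets, if_neg h, mem_filter]; simp

theorem IsPattern.le_of_mem_targets (hP : IsPattern V R) {e : Fin t × Fin m} {x : Fin t}
    (hx : x ∈ patternTargets V R e) : x ≤ e.1 := by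
  by_cases h : ∃ u, R e u
  · exact (hP.target_lt ((mem_patternTargets_of_exists h).1 hx)).le
  · exact ((mem_patternTargets_of_not_exists h).1 hx).1

theorem IsPattern.mem_targets_and_mem (hP : IsPattern V R) {e : Fin t × Fin m} {x : Fin t}
    (hx : x ∈ patternTargets V R e) : x ∈ V ↔ R e x := by
  by_cases h : ∃ u, R e u
  · have := (mem_patternTargets_of_exists h).1 hx
    exact ⟨fun _ => this, fun _ => hP.target_mem this⟩
  · exact ⟨fun hV => absurd hV ((mem_patternTargets_of_not_exists h).1 hx).2,
      fun hR => absurd ⟨x, hR⟩ h⟩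

theorem IsPattern.card_edges_le (hP : IsPattern V R) :
    (univ.filter fun e : Fin t × Fin m => ∃ u, R e u).card ≤ V.card := by
  refine Finset.card_le_card_of_forall_subsingleton R (fun e he => ?_) ?_
  · obtain ⟨u, hu⟩ := (mem_filter.1 he).2
    exact ⟨u, hP.target_mem hu, hu⟩
  · intro u _ e he e' he'
    exact hP.injective he.2 he'.2

theorem IsPattern.nonempty_targets (hP : IsPattern V R) (e : Fin t × Fin m) :
    (patternTargets V R e).Nonempty := by
  by_cases h : ∃ u, R e u
  · obtain ⟨u, hu⟩ := h
    exact ⟨u, (mem_patternTargets_of_exists ⟨u, hu⟩).2 hu⟩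
  · refine ⟨⟨0, (Nat.zero_le _).trans_lt e.1.isLt⟩,
      (mem_patternTargets_of_not_exists h).2 ⟨Fin.mk_le_of_le_val (Nat.zero_le _), fun hV => ?_⟩⟩
    exact lt_irrefl _ (hP.pos _ hV)

theorem edgeBefore_irrefl (e : Fin t × Fin m) : ¬ edgeBefore e e := by
  simp [edgeBefore]

theorem edgeBefore.fst_le {u e : Fin t × Fin m} (h : edgeBefore u e) : u.1 ≤ e.1 := by
  rcases h with h | h
  · exact h.le
  · exact h.1.le

theorem IsPattern.card_inBefore (hP : IsPattern V R) {ξ : PAConfig t m} {e : Fin t × Fin m}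
    (hξ : ∀ u, edgeBefore u e → ξ u.1 u.2 ∈ patternTargets V R u) {v : Fin t} (hv : v ∈ V) :
    (inBefore ξ e v).card = if ∃ e', edgeBefore e' e ∧ R e' v then 1 else 0 := by
  have hmem : ∀ u, u ∈ inBefore ξ e v ↔ edgeBefore u e ∧ R u v := by
    intro u
    rw [inBefore, mem_filter]
    constructor
    · rintro ⟨-, hu, rfl⟩
      exact ⟨hu, (hP.mem_targets_and_mem (hξ u hu)).1 hv⟩
    · rintro ⟨hu, hR⟩
      exact ⟨mem_univ _, hu,
        hP.functional ((mem_patternTargets_of_exists ⟨v, hR⟩).1 (hξ u hu)) hR⟩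
  split_ifs with h
  · obtain ⟨e', he'⟩ := h
    rw [Finset.card_eq_one]
    refine ⟨e', Finset.ext fun u => ?_⟩
    rw [hmem, Finset.mem_singleton]
    exact ⟨fun hu => hP.injective hu.2 he'.2, fun hu => hu ▸ he'⟩
  · rw [Finset.card_eq_zero]
    exact Finset.eq_empty_of_forall_notMem fun u hu => h ⟨u, (hmem u).1 hu⟩

theorem IsPattern.paNum_eq (hP : IsPattern V R) {ξ : PAConfig t m} {e : Fin t × Fin m}
    (hξ : ∀ u, edgeBefore u e → ξ u.1 u.2 ∈ patternTargets V R u) {v : Fin t} (hv : v ∈ V) :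
    paNum δ ξ e v = patternNum δ R e v := by
  unfold paNum patternNum
  split_ifs with h1 h2 h3
  · subst h1
    have h0 : ¬ ∃ e', edgeBefore e' e ∧ R e' e.1 := by
      rintro ⟨e', hb, hR⟩
      exact absurd (hP.target_lt hR) (not_lt.2 hb.fst_le)
    rw [paDeg_eq, hP.card_inBefore hξ hv, if_neg h0]
    simp [outBefore]
  · rw [paDeg_eq, hP.card_inBefore hξ hv, if_pos h3, outBefore, if_pos h2]
    push_cast; ring
  · rw [paDeg_eq, hP.card_inBefore hξ hv, if_neg h3, outBefore, if_pos h2]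
    push_cast; ring
  · rfl

theorem IsPattern.sum_targets (hP : IsPattern V R) (hm : 0 < m) (hδ : -(m : ℝ) < δ)
    {ξ : PAConfig t m} {e : Fin t × Fin m}
    (hξ : ∀ u, edgeBefore u e → ξ u.1 u.2 ∈ patternTargets V R u) :
    (∑ x ∈ patternTargets V R e, paNum δ ξ e x) / paNorm δ e = patternFactor δ V R e := by
  have hc := (paNorm_pos hm hδ e).ne'
  by_cases h : ∃ u, R e u
  · rw [patternFactor, if_pos h]
    obtain ⟨u, hu⟩ := h
    have hS : patternTargets V R e = {u} := by
      ext x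
      rw [mem_patternTargets_of_exists ⟨u, hu⟩, Finset.mem_singleton]
      exact ⟨fun hx => hP.functional hx hu, fun hx => hx ▸ hu⟩
    have hlt := hP.target_lt hu
    have h0 : ¬ ∃ e', edgeBefore e' e ∧ R e' u := by
      rintro ⟨e', hb, hR⟩
      rw [hP.injective hR hu] at hb
      exact edgeBefore_irrefl _ hb
    rw [hS, Finset.sum_singleton, hP.paNum_eq hξ (hP.target_mem hu), patternNum,
      if_neg hlt.ne, if_pos hlt, if_neg h0, add_zero]
  · rw [patternFactor, if_neg h, eq_sub_iff_add_eq, ← add_div, div_eq_one_iff_eq hc,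
      ← sum_paNum hm δ ξ e fun u hu => hP.le_of_mem_targets (hξ u hu),
      ← Finset.sum_congr rfl fun v hv => hP.paNum_eq (δ := δ) hξ hv,
      ← Finset.sum_sdiff (Finset.subset_univ V)]
    congr 1
    refine Finset.sum_subset (fun x hx => ?_) fun x hx hx' => ?_
    · exact Finset.mem_sdiff.2 ⟨mem_univ _, ((mem_patternTargets_of_not_exists h).1 hx).2⟩
    · have hx1 : ¬ x ≤ e.1 := fun hle => hx'
        ((mem_patternTargets_of_not_exists h).2 ⟨hle, (Finset.mem_sdiff.1 hx).2⟩)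
      rw [paNum, if_neg fun h => hx1 h.le, if_neg fun h => hx1 h.le]

/-- The probability that the edges into `V` are exactly the prescribed ones. -/
theorem IsPattern.patternProb_eq (hP : IsPattern V R) (hm : 0 < m) (hδ : -(m : ℝ) < δ) :
    patternProb δ V R = ∏ e : Fin t × Fin m, patternFactor δ V R e := by
  rw [← sum_piFinset_prod_of_sequential (κ := Fin t ×ₗ Fin m) toLex toLex.injective
    (patternTargets V R) hP.nonempty_targets
    (fun e η => paNum δ (Function.curry η) e (η e) / paNorm δ e) (patternFactor δ V R)]
  · refine Finset.sum_nbij' Function.uncurry Function.curry ?_ ?_ ?_ ?_ ?_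
    · intro ξ hξ
      exact Fintype.mem_piFinset.2 fun e => mem_patternEvent.1 hξ e
    · intro η hη
      exact mem_patternEvent.2 fun e => Fintype.mem_piFinset.1 hη e
    · intro ξ _; rfl
    · intro η _; rfl
    · intro ξ _
      exact paWeight_eq_prod δ ξ
  · intro i ξ j a hij
    rw [← edgeBefore_iff_toLex] at hij
    have hne : i ≠ j := by rintro rfl; exact edgeBefore_irrefl _ hij
    have hji : ¬ edgeBefore j i := by
      rw [edgeBefore_iff_toLex] at hij ⊢; exact not_lt.2 hij.le
    simp only [paNum_update δ ξ i j a _ hji, Function.update_of_ne hne]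
  · intro e η hη
    rw [← hP.sum_targets hm hδ (ξ := Function.curry η) fun u hu =>
      hη u ((edgeBefore_iff_toLex u e).1 hu), Finset.sum_div]
    refine Finset.sum_congr rfl fun x _ => ?_
    simp only [paNum_update δ η e e x _ (edgeBefore_irrefl e), Function.update_self]

theorem IsPattern.patternFactor_nonneg (hP : IsPattern V R) (hm : 0 < m) (hδ : -(m : ℝ) < δ)
    (e : Fin t × Fin m) : 0 ≤ patternFactor δ V R e := by
  choose ξ hξ using hP.nonempty_targets
  rw [← hP.sum_targets hm hδ (ξ := Function.curry ξ) fun u _ => hξ u]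
  exact div_nonneg (Finset.sum_nonneg fun x _ => paNum_nonneg hm hδ _ _ _)
    (paNorm_pos hm hδ e).le

theorem patternProb_nonneg (hm : 0 < m) (hδ : -(m : ℝ) < δ) : 0 ≤ patternProb δ V R :=
  Finset.sum_nonneg fun ξ _ => paWeight_nonneg hm hδ ξ

theorem patternNum_nonneg (hm : 0 < m) (hδ : -(m : ℝ) < δ) (e : Fin t × Fin m) (u : Fin t) :
    0 ≤ patternNum δ R e u := by
  have hm' : (0 : ℝ) < m := by positivity
  have h1 : -1 < δ / m := by rw [lt_div_iff₀ hm']; linarith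
  have : (0:ℝ) ≤ e.2.val := by positivity
  unfold patternNum
  split_ifs
  · rw [mul_div_assoc]; nlinarith
  · linarith
  · linarith
  · rfl

theorem patternNum_le (hm : 0 < m) (hδ : -(m : ℝ) < δ) (e : Fin t × Fin m) (u : Fin t) :
    patternNum δ R e u ≤ if u ≤ e.1 then m + 1 + δ else 0 := by
  have hm' : (0 : ℝ) < m := by positivity
  have h1 : -1 < δ / m := by rw [lt_div_iff₀ hm']; linarith
  have h2 : (e.2.val : ℝ) + 1 ≤ m := by exact_mod_cast e.2.isLt
  unfold patternNum
  split_ifs with h h'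
  · have : ((e.2.val : ℝ) + 1) * (1 + δ / m) ≤ m * (1 + δ / m) :=
      mul_le_mul_of_nonneg_right h2 (by linarith)
    rw [mul_div_assoc]
    have h4 : (m : ℝ) * (δ / m) = δ := by field_simp
    nlinarith
  · exact absurd h.le h'
  all_goals first | linarith | exact absurd (le_of_lt ‹_›) ‹_›

end Pattern

section Correlation

variable {t m : ℕ} {V V' : Finset (Fin t)} {R R' : Fin t × Fin m → Fin t → Prop} {δ : ℝ}

theorem IsPattern.sup (hP : IsPattern V R) (hP' : IsPattern V' R') (hd : Disjoint V V') :
    IsPattern (V ∪ V') (fun e u => R e u ∨ R' e u) where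
  target_mem h := Finset.mem_union.2 (h.imp hP.target_mem hP'.target_mem)
  source_mem h := Finset.mem_union.2 (h.imp hP.source_mem hP'.source_mem)
  target_lt h := h.elim hP.target_lt hP'.target_lt
  functional := by
    rintro e u u' (h | h) (h' | h')
    · exact hP.functional h h'
    · exact absurd (hP'.source_mem h') (Finset.disjoint_left.1 hd (hP.source_mem h))
    · exact absurd (hP'.source_mem h) (Finset.disjoint_left.1 hd (hP.source_mem h'))
    · exact hP'.functional h h'
  injective := by
    rintro e u u' (h | h) (h' | h')
    · exact hP.injective h h'
    · exact absurd (hP'.target_mem h') (Finset.disjoint_left.1 hd (hP.target_mem h))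
    · exact absurd (hP'.target_mem h) (Finset.disjoint_left.1 hd (hP.target_mem h'))
    · exact hP'.injective h h'
  pos u hu := (Finset.mem_union.1 hu).elim (hP.pos u) (hP'.pos u)

theorem mem_patternTargets_sup (hP : IsPattern V R) (hP' : IsPattern V' R') (hd : Disjoint V V')
    (e : Fin t × Fin m) (x : Fin t) :
    x ∈ patternTargets (V ∪ V') (fun e u => R e u ∨ R' e u) e ↔
      x ∈ patternTargets V R e ∧ x ∈ patternTargets V' R' e := by
  by_cases h : ∃ u, R e u
  · have h' : ¬ ∃ u, R' e u := by
      rintro ⟨u', hu'⟩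
      obtain ⟨u, hu⟩ := h
      exact Finset.disjoint_left.1 hd (hP.source_mem hu) (hP'.source_mem hu')
    rw [mem_patternTargets_of_exists (h.imp fun _ => Or.inl), mem_patternTargets_of_exists h,
      mem_patternTargets_of_not_exists h']
    constructor
    · rintro (hx | hx)
      · exact ⟨hx, (hP.target_lt hx).le, Finset.disjoint_left.1 hd (hP.target_mem hx)⟩
      · exact absurd ⟨x, hx⟩ h'
    · exact fun hx => Or.inl hx.1
  · rw [mem_patternTargets_of_not_exists h]
    by_cases h' : ∃ u, R' e u
    · rw [mem_patternTargets_of_exists (h'.imp fun _ => Or.inr), mem_patternTargets_of_exists h']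
      constructor
      · rintro (hx | hx)
        · exact absurd ⟨x, hx⟩ h
        · exact ⟨⟨(hP'.target_lt hx).le, Finset.disjoint_right.1 hd (hP'.target_mem hx)⟩, hx⟩
      · exact fun hx => Or.inr hx.2
    · rw [mem_patternTargets_of_not_exists h', mem_patternTargets_of_not_exists]
      · rw [Finset.mem_union]; tauto
      · rintro ⟨u, hu | hu⟩
        · exact h ⟨u, hu⟩
        · exact h' ⟨u, hu⟩

theorem patternEvent_inter (hP : IsPattern V R) (hP' : IsPattern V' R') (hd : Disjoint V V') :
    patternEvent V R ∩ patternEvent V' R' =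
      patternEvent (V ∪ V') (fun e u => R e u ∨ R' e u) := by
  ext ξ
  simp only [Finset.mem_inter, mem_patternEvent, mem_patternTargets_sup hP hP' hd, forall_and]

theorem exp_neg_four_mul_le {x : ℝ} (h0 : 0 ≤ x) (h1 : x ≤ 3 / 4) :
    Real.exp (-(4 * x)) ≤ 1 - x := by
  rw [Real.exp_neg, inv_le_comm₀ (Real.exp_pos _) (by linarith)]
  refine le_trans ?_ (Real.add_one_le_exp _)
  rw [inv_le_iff_one_le_mul₀ (by linarith)]
  nlinarith

theorem sum_patternNum_le (hm : 0 < m) (hδ : -(m : ℝ) < δ) (e : Fin t × Fin m) :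
    ∑ u ∈ V, patternNum δ R e u ≤ (V.filter fun u => u ≤ e.1).card * (m + 1 + δ) := by
  refine (Finset.sum_le_sum fun u _ => patternNum_le hm hδ e u).trans ?_
  rw [← Finset.sum_filter, Finset.sum_const, nsmul_eq_mul]

theorem IsPattern.exp_le_patternFactor (hP : IsPattern V R) (hm : 2 ≤ m) (hδ : -(m : ℝ) < δ)
    (hδ₂ : δ < 0) (e : Fin t × Fin m) (he : e.1 ∉ V) (het : t ≤ 4 * e.1.val) :
    Real.exp (-(12 * V.card / t)) ≤ patternFactor δ V R e := by
  have hm0 : 0 < m := by omega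
  have hm2 : (2 : ℝ) ≤ m := by exact_mod_cast hm
  have ht : 0 < t := (Nat.zero_le _).trans_lt e.1.isLt
  have htR : (0 : ℝ) < t := by exact_mod_cast ht
  have hs : (0 : ℝ) < e.1.val := by
    have : 0 < e.1.val := by omega
    exact_mod_cast this
  have hst : (t : ℝ) ≤ 4 * e.1.val := by exact_mod_cast het
  have hc := paNorm_pos hm0 hδ e
  have hR : ¬ ∃ u, R e u := fun ⟨u, hu⟩ => he (hP.source_mem hu)
  rw [patternFactor, if_neg hR]
  set N := (V.filter fun u => u ≤ e.1).card with hN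
  have hN1 : (N : ℝ) ≤ V.card := by exact_mod_cast Finset.card_filter_le _ _
  have hN2 : (N : ℝ) ≤ e.1.val := by
    rw [← card_filter_fin_lt e.1]
    norm_cast
    refine Finset.card_le_card fun u hu => ?_
    obtain ⟨hu1, hu2⟩ := mem_filter.1 hu
    exact mem_filter.2 ⟨mem_univ _, lt_of_le_of_ne hu2 fun h => he (h ▸ hu1)⟩
  set w := ∑ u ∈ V, patternNum δ R e u with hw
  have hw0 : 0 ≤ w := Finset.sum_nonneg fun u _ => patternNum_nonneg hm0 hδ e u
  have hw1 : w ≤ N * (m + 1 + δ) := sum_patternNum_le hm0 hδ e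
  have hx : w / paNorm δ e ≤ 3 / 4 * (N / e.1.val) := by
    rw [div_le_iff₀ hc]
    have h1 : (m : ℝ) + 1 + δ ≤ 3 / 4 * (2 * m + δ) := by linarith
    calc w ≤ N * (3 / 4 * (2 * m + δ)) := hw1.trans (by gcongr)
      _ = 3 / 4 * (N / e.1.val) * (e.1.val * (2 * m + δ)) := by field_simp
      _ ≤ _ := by
        have := (paNorm_ge hm0 hδ e).le
        gcongr
  have hx1 : w / paNorm δ e ≤ 3 / 4 := by
    have : (N : ℝ) / e.1.val ≤ 1 := (div_le_one hs).2 hN2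
    linarith
  refine le_trans ?_ (exp_neg_four_mul_le (div_nonneg hw0 hc.le) hx1)
  rw [Real.exp_le_exp, neg_le_neg_iff]
  have h2 : (N : ℝ) / e.1.val ≤ 4 * V.card / t := by
    rw [div_le_div_iff₀ hs htR]
    have : (0:ℝ) ≤ N := by positivity
    nlinarith
  have h3 : 12 * (V.card : ℝ) / t = 3 * (4 * V.card / t) := by ring
  linarith

/-- Two disjoint patterns are almost negatively correlated. -/
theorem patternProb_sup_le (hP : IsPattern V R) (hP' : IsPattern V' R') (hd : Disjoint V V')
    (hm : 2 ≤ m) (hδ : -(m : ℝ) < δ) (hδ₂ : δ < 0) {n : ℕ} (hn : V.card = n) (hn' : V'.card = n)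
    (hs : ∀ e u, R e u → t ≤ 4 * e.1.val) (hs' : ∀ e u, R' e u → t ≤ 4 * e.1.val) :
    patternProb δ (V ∪ V') (fun e u => R e u ∨ R' e u) ≤
      Real.exp (24 * (n : ℝ) ^ 2 / t) * (patternProb δ V R * patternProb δ V' R') := by
  have hm0 : 0 < m := by omega
  have hP'' := hP.sup hP' hd
  have hfac : ∀ e : Fin t × Fin m,
      patternFactor δ (V ∪ V') (fun e u => R e u ∨ R' e u) e ≤
        (if ∃ u, R e u ∨ R' e u then Real.exp (12 * n / t) else 1) *
          (patternFactor δ V R e * patternFactor δ V' R' e) := by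
    intro e
    have hc := paNorm_pos hm0 hδ e
    have hnum : ∀ u, u ∈ V → patternNum δ (fun e u => R e u ∨ R' e u) e u =
        patternNum δ R e u := by
      intro u hu
      have : ∀ e', R e' u ∨ R' e' u ↔ R e' u := fun e' =>
        or_iff_left fun h => Finset.disjoint_left.1 hd hu (hP'.target_mem h)
      simp only [patternNum, this]
    have hnum' : ∀ u, u ∈ V' → patternNum δ (fun e u => R e u ∨ R' e u) e u =
        patternNum δ R' e u := by
      intro u hu
      have : ∀ e', R e' u ∨ R' e' u ↔ R' e' u := fun e' =>
        or_iff_right fun h => Finset.disjoint_right.1 hd hu (hP.target_mem h)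
      simp only [patternNum, this]
    have hexp : Real.exp (12 * n / t) * Real.exp (-(12 * n / t)) = 1 := by
      rw [← Real.exp_add]; simp
    have hmd : 0 ≤ ((m : ℝ) + δ) / paNorm δ e := div_nonneg (by linarith) hc.le
    by_cases h : ∃ u, R e u
    · obtain ⟨u, hu⟩ := h
      have hge := hP'.exp_le_patternFactor hm hδ hδ₂ e
        (Finset.disjoint_left.1 hd (hP.source_mem hu)) (hs e u hu)
      rw [hn'] at hge
      rw [if_pos ⟨u, Or.inl hu⟩, patternFactor, if_pos ⟨u, Or.inl hu⟩, patternFactor,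
        if_pos ⟨u, hu⟩]
      calc ((m : ℝ) + δ) / paNorm δ e
          = (Real.exp (12 * n / t) * Real.exp (-(12 * n / t))) * ((m + δ) / paNorm δ e) := by
            rw [hexp, one_mul]
        _ = Real.exp (12 * n / t) * ((m + δ) / paNorm δ e * Real.exp (-(12 * n / t))) := by ring
        _ ≤ _ := by gcongr
    by_cases h' : ∃ u, R' e u
    · obtain ⟨u, hu⟩ := h'
      have hge := hP.exp_le_patternFactor hm hδ hδ₂ e
        (Finset.disjoint_right.1 hd (hP'.source_mem hu)) (hs' e u hu)
      rw [hn] at hge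
      rw [if_pos ⟨u, Or.inr hu⟩, patternFactor, if_pos ⟨u, Or.inr hu⟩]
      nth_rw 2 [patternFactor]
      rw [if_pos ⟨u, hu⟩]
      calc ((m : ℝ) + δ) / paNorm δ e
          = (Real.exp (12 * n / t) * Real.exp (-(12 * n / t))) * ((m + δ) / paNorm δ e) := by
            rw [hexp, one_mul]
        _ = Real.exp (12 * n / t) * (Real.exp (-(12 * n / t)) * ((m + δ) / paNorm δ e)) := by ring
        _ ≤ _ := by gcongr
    have h'' : ¬ ∃ u, R e u ∨ R' e u := by
      rintro ⟨u, hu | hu⟩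
      · exact h ⟨u, hu⟩
      · exact h' ⟨u, hu⟩
    rw [if_neg h'', one_mul, patternFactor, if_neg h'', patternFactor, if_neg h, patternFactor,
      if_neg h', Finset.sum_union hd, Finset.sum_congr rfl hnum, Finset.sum_congr rfl hnum',
      add_div]
    have h1 : 0 ≤ (∑ u ∈ V, patternNum δ R e u) / paNorm δ e :=
      div_nonneg (Finset.sum_nonneg fun u _ => patternNum_nonneg hm0 hδ e u) hc.le
    have h2 : 0 ≤ (∑ u ∈ V', patternNum δ R' e u) / paNorm δ e :=
      div_nonneg (Finset.sum_nonneg fun u _ => patternNum_nonneg hm0 hδ e u) hc.le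
    nlinarith [mul_nonneg h1 h2]
  rw [hP''.patternProb_eq hm0 hδ, hP.patternProb_eq hm0 hδ, hP'.patternProb_eq hm0 hδ]
  refine (Finset.prod_le_prod (fun e _ => hP''.patternFactor_nonneg hm0 hδ e)
    fun e _ => hfac e).trans ?_
  rw [Finset.prod_mul_distrib, Finset.prod_mul_distrib, Finset.prod_ite, Finset.prod_const_one,
    mul_one, Finset.prod_const]
  refine mul_le_mul_of_nonneg_right ?_ (mul_nonneg
    (Finset.prod_nonneg fun e _ => hP.patternFactor_nonneg hm0 hδ e)
    (Finset.prod_nonneg fun e _ => hP'.patternFactor_nonneg hm0 hδ e))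
  have hcard := hP''.card_edges_le
  rw [Finset.card_union_of_disjoint hd, hn, hn'] at hcard
  refine (pow_le_pow_right₀ (n := n + n) (Real.one_le_exp (x := 12 * (n : ℝ) / t) (by positivity)) ?_).trans ?_
  · convert hcard
  rw [← Real.exp_nat_mul]
  refine le_of_eq (congrArg _ ?_)
  push_cast
  ring

end Correlation

section Tree

theorem graphDist_le_iff {α : Type*} (A : α → α → Prop) (u v : α) (k : ℕ) :
    graphDist A u v ≤ (k : ℕ∞) ↔ ∃ i ≤ k, reachIn A u v i := by
  constructor
  · intro h
    by_contra! hn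
    have : ((k + 1 : ℕ) : ℕ∞) ≤ graphDist A u v := by
      refine le_iInf₂ fun i hi => ?_
      have : k < i := not_le.1 fun hle => hn i hle hi
      exact_mod_cast this
    have h2 : ((k + 1 : ℕ) : ℕ∞) ≤ (k : ℕ∞) := this.trans h
    have h3 : k + 1 ≤ k := by exact_mod_cast h2
    omega
  · rintro ⟨i, hi, hr⟩
    exact (iInf₂_le i hr).trans (by exact_mod_cast hi)

theorem reachIn_zero_iff {α : Type*} (A : α → α → Prop) (u v : α) :
    reachIn A u v 0 ↔ v = u := by
  constructor
  · rintro ⟨p, h0, h1, -⟩; rw [← h0, ← h1]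
  · rintro rfl; exact ⟨fun _ => v, rfl, rfl, by simp⟩

theorem reachIn_succ_iff {α : Type*} (A : α → α → Prop) (u v : α) (k : ℕ) :
    reachIn A u v (k + 1) ↔ ∃ z, reachIn A u z k ∧ A z v := by
  constructor
  · rintro ⟨p, h0, h1, h⟩
    exact ⟨p k, ⟨p, h0, rfl, fun i hi => h i (by omega)⟩, h1 ▸ h k (by omega)⟩
  · rintro ⟨z, ⟨p, h0, h1, h⟩, hz⟩
    refine ⟨fun i => if i ≤ k then p i else v, by simpa using h0, by simp, fun i hi => ?_⟩
    rcases Nat.lt_succ_iff_lt_or_eq.1 hi with hi | rfl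
    · have h2 : i + 1 ≤ k := hi
      simpa [hi.le, h2] using h i hi
    · simpa [h1] using hz

variable {t m : ℕ}

theorem mem_paBallF_zero {ξ : PAConfig t m} {v u : Fin t} : u ∈ paBallF ξ v 0 ↔ u = v := by
  rw [paBallF, mem_filter, graphDist_le_iff]
  simp [reachIn_zero_iff]

theorem mem_paBallF_succ {ξ : PAConfig t m} {v u : Fin t} {k : ℕ} :
    u ∈ paBallF ξ v (k + 1) ↔ u ∈ paBallF ξ v k ∨ ∃ z ∈ paBallF ξ v k, paAdj ξ z u := by
  simp only [paBallF, mem_filter, mem_univ, true_and, graphDist_le_iff]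
  constructor
  · rintro ⟨i, hi, hr⟩
    rcases Nat.le_succ_iff.1 hi with hi | rfl
    · exact Or.inl ⟨i, hi, hr⟩
    · obtain ⟨z, hz, ha⟩ := (reachIn_succ_iff _ _ _ _).1 hr
      exact Or.inr ⟨z, ⟨k, le_rfl, hz⟩, ha⟩
  · rintro (⟨i, hi, hr⟩ | ⟨z, ⟨i, hi, hr⟩, ha⟩)
    · exact ⟨i, by omega, hr⟩
    · exact ⟨i + 1, by omega, (reachIn_succ_iff _ _ _ _).2 ⟨z, hr, ha⟩⟩

theorem paBallF_mono {ξ : PAConfig t m} {v : Fin t} {k l : ℕ} (h : k ≤ l) :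
    paBallF ξ v k ⊆ paBallF ξ v l := by
  induction h with
  | refl => exact Finset.Subset.refl _
  | step _ ih => exact ih.trans fun u hu => mem_paBallF_succ.2 (Or.inl hu)

theorem paik_succ (m k : ℕ) : paik m (k + 1) = m * paik m k + 1 := by
  rw [paik, paik, Finset.sum_range_succ', Finset.mul_sum]
  simp [pow_succ, mul_comm]

theorem paik_zero (m : ℕ) : paik m 0 = 1 := by simp [paik]

theorem paik_pos (m k : ℕ) : 0 < paik m k := by
  cases k with
  | zero => simp [paik_zero]
  | succ k => simp [paik_succ]

theorem paik_mono (m : ℕ) : Monotone (paik m) := fun _ _ h =>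
  Finset.sum_le_sum_of_subset (Finset.range_mono (Nat.succ_le_succ h))

/-- The breadth-first enumeration of the tree of descendants (older endpoints) of `v`: the
entries `m * a + 1, …, m * a + m` are the targets of the `m` edges of the entry `a`. -/
def treeSeq (hm : 0 < m) (ξ : PAConfig t m) (v : Fin t) : ℕ → Fin t
  | 0 => v
  | b + 1 => ξ (treeSeq hm ξ v (b / m)) ⟨b % m, Nat.mod_lt _ hm⟩
termination_by a => a
decreasing_by exact Nat.lt_succ_of_le (Nat.div_le_self _ _)

theorem treeSeq_zero (hm : 0 < m) (ξ : PAConfig t m) (v : Fin t) : treeSeq hm ξ v 0 = v := by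
  rw [treeSeq]

theorem treeSeq_succ (hm : 0 < m) (ξ : PAConfig t m) (v : Fin t) (b : ℕ) :
    treeSeq hm ξ v (b + 1) = ξ (treeSeq hm ξ v (b / m)) ⟨b % m, Nat.mod_lt _ hm⟩ := by
  rw [treeSeq]

theorem treeSeq_child (hm : 0 < m) (ξ : PAConfig t m) (v : Fin t) (a : ℕ) (j : Fin m) :
    treeSeq hm ξ v (m * a + j.val + 1) = ξ (treeSeq hm ξ v a) j := by
  have h1 : (m * a + j.val) / m = a := by
    rw [Nat.mul_add_div hm, Nat.div_eq_of_lt j.isLt, add_zero]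
  have h2 : (m * a + j.val) % m = j.val := by
    rw [Nat.mul_add_mod, Nat.mod_eq_of_lt j.isLt]
  rw [treeSeq_succ]
  congr 1
  · rw [h1]
  · exact Fin.ext h2

/-- The ball around `v` is enumerated by `treeSeq` if all edges into it come from entries of
smaller index. -/
theorem paBallF_eq_image_treeSeq (hm : 0 < m) (ξ : PAConfig t m) (v : Fin t) (k : ℕ)
    (hin : ∀ a < paik m k, treeSeq hm ξ v a ∈ paBallF ξ v k → ∀ u j, ξ u j = treeSeq hm ξ v a →
      ∃ b < a, u = treeSeq hm ξ v b) :
    ∀ d ≤ k, paBallF ξ v d = (Finset.range (paik m d)).image (treeSeq hm ξ v) := by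
  intro d
  induction d with
  | zero =>
    intro _
    ext u
    rw [mem_paBallF_zero]
    simp [paik_zero, treeSeq_zero, eq_comm]
  | succ d ih =>
    intro hd
    have ih := ih (by omega)
    ext u
    rw [mem_paBallF_succ]
    simp only [ih, Finset.mem_image, Finset.mem_range]
    constructor
    · rintro (⟨a, ha, rfl⟩ | ⟨z, ⟨a, ha, rfl⟩, j, hj | hj⟩)
      · exact ⟨a, ha.trans_le (paik_mono m (Nat.le_succ d)), rfl⟩
      · refine ⟨m * a + j.val + 1, ?_, by rw [treeSeq_child, hj]⟩
        rw [paik_succ]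
        have : m * (a + 1) ≤ m * paik m d := Nat.mul_le_mul_left m ha
        have := j.isLt
        rw [Nat.mul_succ] at *
        omega
      · obtain ⟨b, hb, rfl⟩ := hin a (ha.trans_le (paik_mono m (by omega)))
          (paBallF_mono (by omega : d ≤ k)
            (ih ▸ Finset.mem_image_of_mem _ (Finset.mem_range.2 ha))) u j hj
        exact ⟨b, (hb.trans ha).trans_le (paik_mono m (Nat.le_succ d)), rfl⟩
    · rintro ⟨b, hb, rfl⟩
      cases b with
      | zero => exact Or.inl ⟨0, paik_pos m d, rfl⟩
      | succ b =>
        refine Or.inr ⟨_, ⟨b / m, ?_, rfl⟩, ⟨b % m, Nat.mod_lt _ hm⟩,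
          Or.inl (treeSeq_succ hm ξ v b).symm⟩
        rw [paik_succ] at hb
        exact Nat.div_lt_of_lt_mul (by omega)

/-- Prescribed edges of the `m`-ary tree with vertices `x` in breadth-first order. -/
def treeEdge {n : ℕ} (x : Fin n → Fin t) (e : Fin t × Fin m) (u : Fin t) : Prop :=
  ∃ a b : Fin n, b.val = m * a.val + e.2.val + 1 ∧ e.1 = x a ∧ u = x b

/-- `x` is a possible breadth-first enumeration of the neighbourhood of a minimally-connected
vertex. -/
structure IsTreeTuple (m : ℕ) {t n : ℕ} (x : Fin n → Fin t) : Prop where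
  injective : Function.Injective x
  pos : ∀ a, 0 < (x a).val
  root : ∀ a, a.val = 0 → t / 2 ≤ (x a).val
  inner : ∀ a, a.val ≠ 0 → t / 4 ≤ (x a).val ∧ (x a).val < t / 2
  decreasing : ∀ a b : Fin n, ∀ j : Fin m, b.val = m * a.val + j.val + 1 → x b < x a

variable {n : ℕ} {x y : Fin n → Fin t}

theorem child_index_injective {a a' j j' : ℕ} (hj : j < m) (hj' : j' < m)
    (h : m * a + j + 1 = m * a' + j' + 1) : a = a' ∧ j = j' := by
  have hm : 0 < m := (Nat.zero_le _).trans_lt hj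
  have h0 : m * a + j = m * a' + j' := by omega
  have h1 := congrArg (· / m) h0
  simp only [Nat.mul_add_div hm, Nat.div_eq_of_lt hj, Nat.div_eq_of_lt hj', add_zero] at h1
  subst h1
  exact ⟨rfl, by omega⟩

theorem IsTreeTuple.isPattern (hx : IsTreeTuple m x) :
    IsPattern (univ.image x) (treeEdge (m := m) x) where
  target_mem := by
    rintro e u ⟨a, b, -, -, rfl⟩; exact Finset.mem_image_of_mem _ (mem_univ _)
  source_mem := by
    rintro e u ⟨a, b, -, h, -⟩; rw [h]; exact Finset.mem_image_of_mem _ (mem_univ _)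
  target_lt := by
    rintro e u ⟨a, b, h, h', rfl⟩; rw [h']; exact hx.decreasing a b e.2 h
  functional := by
    rintro e u u' ⟨a, b, h1, h2, rfl⟩ ⟨a', b', h1', h2', rfl⟩
    have : a = a' := hx.injective (h2.symm.trans h2')
    subst this
    rw [Fin.ext (h1.trans h1'.symm)]
  injective := by
    rintro e e' u ⟨a, b, h1, h2, h3⟩ ⟨a', b', h1', h2', h3'⟩
    have : b = b' := hx.injective (h3.symm.trans h3')
    subst this
    obtain ⟨ha, hj⟩ := child_index_injective e.2.isLt e'.2.isLt (h1.symm.trans h1')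
    have ha : a = a' := Fin.ext ha
    subst ha
    exact Prod.ext (h2.trans h2'.symm) (Fin.ext hj)
  pos := by
    intro u hu
    obtain ⟨a, -, rfl⟩ := Finset.mem_image.1 hu
    exact hx.pos a

theorem IsTreeTuple.source_low (hx : IsTreeTuple m x) (e : Fin t × Fin m) (u : Fin t)
    (h : treeEdge x e u) : t ≤ 4 * e.1.val := by
  have hlt : u.val < e.1.val := hx.isPattern.target_lt h
  obtain ⟨a, b, h1, -, rfl⟩ := h
  have := hx.inner b (by omega)
  omega

theorem IsTreeTuple.card_edges (hm : 0 < m) (hx : IsTreeTuple m x) :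
    (univ.filter fun e : Fin t × Fin m => ∃ u, treeEdge x e u).card = n - 1 := by
  have h1 : n - 1 = (univ.filter fun b : Fin n => b.val ≠ 0).card := by
    cases n with
    | zero => simp
    | succ n =>
      have : (univ.filter fun b : Fin (n + 1) => b.val ≠ 0) = univ.erase 0 := by
        ext b
        rw [mem_filter, Finset.mem_erase]
        exact ⟨fun h => ⟨fun h0 => h.2 (h0 ▸ rfl), mem_univ _⟩,
          fun h => ⟨mem_univ _, fun h0 => h.1 (Fin.ext h0)⟩⟩
      rw [this, Finset.card_erase_of_mem (mem_univ _)]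
      simp
  rw [h1]
  symm
  refine Finset.card_bij (fun b _ => (x ⟨(b.val - 1) / m,
      ((Nat.div_le_self _ _).trans (Nat.sub_le _ _)).trans_lt b.isLt⟩,
      ⟨(b.val - 1) % m, Nat.mod_lt _ hm⟩)) ?_ ?_ ?_
  · intro b hb
    have hb := (mem_filter.1 hb).2
    refine mem_filter.2 ⟨mem_univ _, x b, _, b, ?_, rfl, rfl⟩
    have := Nat.div_add_mod (b.val - 1) m
    simp only
    omega
  · intro b hb b' hb' h
    have hb := (mem_filter.1 hb).2
    have hb' := (mem_filter.1 hb').2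
    obtain ⟨h1, h2⟩ := Prod.mk.inj h
    have h1 := congrArg Fin.val (hx.injective h1)
    have h2 := congrArg Fin.val h2
    simp only at h1 h2
    have e1 := Nat.div_add_mod (b.val - 1) m
    have e2 := Nat.div_add_mod (b'.val - 1) m
    rw [h1, h2] at e1
    exact Fin.ext (by omega)
  · intro e he
    obtain ⟨u, a, b, h1, h2, h3⟩ := (mem_filter.1 he).2
    refine ⟨b, mem_filter.2 ⟨mem_univ _, by omega⟩, ?_⟩
    have h4 : b.val - 1 = m * a.val + e.2.val := by omega
    refine Prod.ext ?_ (Fin.ext ?_)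
    · rw [h2]
      refine congrArg x (Fin.ext ?_)
      change (b.val - 1) / m = a.val
      rw [h4, Nat.mul_add_div hm, Nat.div_eq_of_lt e.2.isLt, add_zero]
    · change (b.val - 1) % m = e.2.val
      rw [h4, Nat.mul_add_mod, Nat.mod_eq_of_lt e.2.isLt]

/-- The event that `x` is realized as a tree with no further edges into it. -/
abbrev treeEvent (m : ℕ) {t n : ℕ} (x : Fin n → Fin t) : Finset (PAConfig t m) :=
  patternEvent (univ.image x) (treeEdge x)

theorem IsTreeTuple.edge_iff (hx : IsTreeTuple m x) {ξ : PAConfig t m} (hξ : ξ ∈ treeEvent m x)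
    (e : Fin t × Fin m) (b : Fin n) : ξ e.1 e.2 = x b ↔ treeEdge x e (x b) := by
  have h := mem_patternEvent.1 hξ e
  constructor
  · intro he
    rw [← he]
    exact (hx.isPattern.mem_targets_and_mem h).1
      (he ▸ Finset.mem_image_of_mem _ (mem_univ _))
  · intro he
    exact hx.isPattern.functional ((mem_patternTargets_of_exists ⟨_, he⟩).1 h) he

theorem IsTreeTuple.eq_treeSeq (hm : 0 < m) (hx : IsTreeTuple m x) {ξ : PAConfig t m}
    (hξ : ξ ∈ treeEvent m x) (hn : 0 < n) (a : Fin n) :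
    x a = treeSeq hm ξ (x ⟨0, hn⟩) a.val := by
  obtain ⟨a, ha⟩ := a
  induction a using Nat.strong_induction_on with
  | _ a ih =>
    cases a with
    | zero => rw [treeSeq_zero]
    | succ a =>
      have hle : a / m ≤ a := Nat.div_le_self _ _
      rw [treeSeq_succ, ← ih (a / m) (by omega) (by omega)]
      symm
      refine (hx.edge_iff hξ (_, _) _).2 ⟨⟨a / m, by omega⟩, ⟨a + 1, ha⟩, ?_, rfl, rfl⟩
      have := Nat.div_add_mod a m
      simp only
      omega

end Tree

section MinimallyConnected

variable {t m k : ℕ}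

theorem IsTreeTuple.paMinConn (hm : 0 < m) {x : Fin (paik m k) → Fin t} (hx : IsTreeTuple m x)
    {ξ : PAConfig t m} (hξ : ξ ∈ treeEvent m x) : paMinConn ξ (x ⟨0, paik_pos m k⟩) k := by
  have hseq := hx.eq_treeSeq hm hξ (paik_pos m k)
  have hball : paBallF ξ (x ⟨0, paik_pos m k⟩) k = univ.image x := by
    rw [paBallF_eq_image_treeSeq hm ξ _ k ?_ k le_rfl]
    · ext u
      simp only [Finset.mem_image, Finset.mem_range, mem_univ, true_and]
      constructor
      · rintro ⟨a, ha, rfl⟩; exact ⟨⟨a, ha⟩, hseq _⟩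
      · rintro ⟨a, rfl⟩; exact ⟨a, a.isLt, (hseq a).symm⟩
    · intro a ha _ u j huj
      rw [← hseq ⟨a, ha⟩] at huj
      obtain ⟨a', b, h1, h2, h3⟩ := (hx.edge_iff hξ (u, j) _).1 huj
      have hab : a = b.val := congrArg Fin.val (hx.injective h3)
      refine ⟨a'.val, ?_, by rw [← hseq]; exact h2⟩
      have := Nat.le_mul_of_pos_left a'.val hm
      omega
  have hindeg : ∀ a, (univ.filter fun u : Fin t × Fin m => ξ u.1 u.2 = x a) =
      univ.filter fun u : Fin t × Fin m => treeEdge x u (x a) :=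
    fun a => Finset.filter_congr fun u _ => hx.edge_iff hξ u a
  refine ⟨hx.root _ rfl, ?_, ?_, ?_, ?_⟩
  · rw [paDegT_eq, hindeg, Finset.card_eq_zero.2, zero_add]
    refine Finset.filter_eq_empty_iff.2 fun u _ => ?_
    rintro ⟨a, b, h1, -, h2⟩
    have := congrArg Fin.val (hx.injective h2)
    simp only at this
    omega
  · intro u hu hne
    rw [hball] at hu
    obtain ⟨b, -, rfl⟩ := Finset.mem_image.1 hu
    have hb : b.val ≠ 0 := fun h => hne (congrArg x (Fin.ext h))
    refine ⟨hx.inner b hb, ?_⟩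
    rw [paDegT_eq, hindeg, add_comm, Finset.card_eq_one.2]
    have hlt : (b.val - 1) / m < paik m k :=
      ((Nat.div_le_self _ _).trans (Nat.sub_le _ _)).trans_lt b.isLt
    have he : treeEdge x (x ⟨(b.val - 1) / m, hlt⟩, ⟨(b.val - 1) % m, Nat.mod_lt _ hm⟩) (x b) := by
      refine ⟨_, b, ?_, rfl, rfl⟩
      have := Nat.div_add_mod (b.val - 1) m
      simp only
      omega
    refine ⟨(x ⟨(b.val - 1) / m, hlt⟩, ⟨(b.val - 1) % m, Nat.mod_lt _ hm⟩),
      Finset.ext fun e => ?_⟩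
    rw [mem_filter, Finset.mem_singleton]
    exact ⟨fun h => hx.isPattern.injective h.2 he, fun h => ⟨mem_univ _, h ▸ he⟩⟩
  · rw [hball, Finset.card_image_of_injective _ hx.injective, Finset.card_univ, Fintype.card_fin]
  · rw [hball, ← hx.card_edges hm]
    congr 1
    refine Finset.filter_congr fun e _ => ?_
    have hmem := mem_patternEvent.1 hξ e
    constructor
    · rintro ⟨-, h⟩
      exact ⟨_, (hx.isPattern.mem_targets_and_mem hmem).1 h⟩
    · rintro ⟨u, hu⟩
      refine ⟨hx.isPattern.source_mem hu, ?_⟩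
      rw [hx.isPattern.functional ((mem_patternTargets_of_exists ⟨_, hu⟩).1 hmem) hu]
      exact hx.isPattern.target_mem hu

theorem exists_isTreeTuple_of_paMinConn (hm : 2 ≤ m) {ξ : PAConfig t m}
    (hξ : ∀ e : Fin t × Fin m, ξ e.1 e.2 ≤ e.1) {v : Fin t} (hv : paMinConn ξ v k) :
    ∃ x : Fin (paik m k) → Fin t,
      IsTreeTuple m x ∧ ξ ∈ treeEvent m x ∧ x ⟨0, paik_pos m k⟩ = v := by
  have hm0 : 0 < m := by omega
  obtain ⟨hroot, hdeg, hother, hcard, -⟩ := hv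
  rw [paDegT_eq] at hdeg
  have hin0 : ∀ e : Fin t × Fin m, ξ e.1 e.2 ≠ v := by
    have : (univ.filter fun u : Fin t × Fin m => ξ u.1 u.2 = v) = ∅ :=
      Finset.card_eq_zero.1 (by omega)
    exact fun e => Finset.filter_eq_empty_iff.1 this (mem_univ e)
  have hin1 : ∀ e e' : Fin t × Fin m, ξ e.1 e.2 ∈ paBallF ξ v k →
      ξ e'.1 e'.2 = ξ e.1 e.2 → e' = e := by
    intro e e' he hee'
    have h := (hother _ he (hin0 e)).2
    rw [paDegT_eq] at h
    have h1 : (univ.filter fun u : Fin t × Fin m => ξ u.1 u.2 = ξ e.1 e.2).card ≤ 1 := by omega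
    exact Finset.card_le_one.1 h1 e' (mem_filter.2 ⟨mem_univ _, hee'⟩) e
      (mem_filter.2 ⟨mem_univ _, rfl⟩)
  set y := treeSeq hm0 ξ v with hy
  have hpar : ∀ a, y a ∈ paBallF ξ v k → ∀ e : Fin t × Fin m, ξ e.1 e.2 = y a →
      ∃ a', ∃ h : a = m * a' + e.2.val + 1, e.1 = y a' := by
    intro a ha e he
    cases a with
    | zero => exact absurd (he.trans (treeSeq_zero hm0 ξ v)) (hin0 e)
    | succ b =>
      have hs := treeSeq_succ hm0 ξ v b
      rw [← hy] at hs
      have := hin1 (y (b / m), ⟨b % m, Nat.mod_lt _ hm0⟩) e (hs ▸ ha) (he.trans hs)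
      refine ⟨b / m, ?_, congrArg Prod.fst this⟩
      rw [this]
      simp only [Nat.div_add_mod]
  have hball : paBallF ξ v k = (Finset.range (paik m k)).image y := by
    refine paBallF_eq_image_treeSeq hm0 ξ v k ?_ k le_rfl
    intro a _ ha u j huj
    obtain ⟨a', h, h'⟩ := hpar a ha (u, j) huj
    refine ⟨a', ?_, h'⟩
    have := Nat.le_mul_of_pos_left a' hm0
    omega
  have hinj : Set.InjOn y (Finset.range (paik m k)) := by
    rw [← Finset.card_image_iff, ← hball, hcard, Finset.card_range]
  have hmem : ∀ a < paik m k, y a ∈ paBallF ξ v k := fun a ha =>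
    hball ▸ Finset.mem_image_of_mem _ (Finset.mem_range.2 ha)
  have hy0 : y 0 = v := treeSeq_zero hm0 ξ v
  have hxinj : Function.Injective fun a : Fin (paik m k) => y a := fun a b h =>
    Fin.ext (hinj (Finset.mem_coe.2 (Finset.mem_range.2 a.isLt))
      (Finset.mem_coe.2 (Finset.mem_range.2 b.isLt)) h)
  have hne : ∀ a : Fin (paik m k), a.val ≠ 0 → y a ≠ v := fun a ha h =>
    ha (congrArg Fin.val (hxinj (a₁ := a) (a₂ := ⟨0, paik_pos m k⟩) (h.trans hy0.symm)))
  have htree : IsTreeTuple m fun a : Fin (paik m k) => y a := by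
    refine ⟨hxinj, fun a => ?_, fun a ha => ?_, fun a ha => ?_, fun a b j h => ?_⟩
    · by_contra h0
      have h0 : (y a).val = 0 := by omega
      have hdle : paDegT ξ (y a) ≤ m + 1 := by
        by_cases hav : y a = v
        · rw [hav, paDegT_eq]; omega
        · exact (hother _ (hmem a a.isLt) hav).2.le
      rw [paDegT_eq] at hdle
      have hloops : (univ.image fun j : Fin m => (y a, j)) ⊆
          univ.filter fun u : Fin t × Fin m => ξ u.1 u.2 = y a := by
        intro u hu
        obtain ⟨j, -, rfl⟩ := Finset.mem_image.1 hu
        refine mem_filter.2 ⟨mem_univ _, Fin.ext ?_⟩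
        have : (ξ (y a) j).val ≤ (y a).val := hξ (y a, j)
        simp only
        omega
      have h2 := Finset.card_le_card hloops
      rw [Finset.card_image_of_injective _ fun a b h => (Prod.mk.inj h).2, Finset.card_univ,
        Fintype.card_fin] at h2
      omega
    · simp only [ha, hy0]; exact hroot
    · exact (hother _ (hmem a a.isLt) (hne a ha)).1
    · have h1 : y b = ξ (y a) j := by
        rw [h]; exact treeSeq_child hm0 ξ v a j
      refine lt_of_le_of_ne (h1 ▸ hξ (y a, j)) fun hab => ?_
      have := congrArg Fin.val (hxinj hab)
      have := Nat.le_mul_of_pos_left a.val hm0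
      omega
  refine ⟨_, htree, mem_patternEvent.2 fun e => ?_, hy0⟩
  by_cases he : ∃ u, treeEdge (fun a : Fin (paik m k) => y a) e u
  · rw [mem_patternTargets_of_exists he]
    obtain ⟨u, a, b, h1, h2, h3⟩ := he
    refine ⟨a, b, h1, h2, ?_⟩
    simp only
    rw [h1, h2]
    exact (treeSeq_child hm0 ξ v a e.2).symm
  · rw [mem_patternTargets_of_not_exists he]
    refine ⟨hξ e, fun hV => he ?_⟩
    obtain ⟨b, -, hb⟩ := Finset.mem_image.1 hV
    obtain ⟨a', h, h'⟩ := hpar b (hmem b b.isLt) e hb.symm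
    have := Nat.le_mul_of_pos_left a' hm0
    have := b.isLt
    exact ⟨y b, ⟨a', by omega⟩, b, h, h', rfl⟩

/-- All possible breadth-first enumerations of neighbourhoods of minimally-connected vertices. -/
def treeTuples (t m k : ℕ) : Finset (Fin (paik m k) → Fin t) :=
  univ.filter fun x => IsTreeTuple m x

theorem IsTreeTuple.eq_of_root_eq (hm : 0 < m) {x y : Fin (paik m k) → Fin t}
    (hx : IsTreeTuple m x) (hy : IsTreeTuple m y) {ξ : PAConfig t m} (hξx : ξ ∈ treeEvent m x)
    (hξy : ξ ∈ treeEvent m y) (h : x ⟨0, paik_pos m k⟩ = y ⟨0, paik_pos m k⟩) : x = y := by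
  funext a
  rw [hx.eq_treeSeq hm hξx (paik_pos m k), hy.eq_treeSeq hm hξy (paik_pos m k), h]

theorem paMk_eq_card (hm : 2 ≤ m) {ξ : PAConfig t m}
    (hξ : ∀ e : Fin t × Fin m, ξ e.1 e.2 ≤ e.1) :
    paMk ξ k = ((treeTuples t m k).filter fun x => ξ ∈ treeEvent m x).card := by
  have hm0 : 0 < m := by omega
  rw [paMk]
  symm
  refine Finset.card_bij (fun x _ => x ⟨0, paik_pos m k⟩) ?_ ?_ ?_
  · intro x hx
    obtain ⟨h1, h2⟩ := mem_filter.1 hx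
    exact mem_filter.2 ⟨mem_univ _, (mem_filter.1 h1).2.paMinConn hm0 h2⟩
  · intro x hx y hy h
    obtain ⟨h1, h2⟩ := mem_filter.1 hx
    obtain ⟨h1', h2'⟩ := mem_filter.1 hy
    exact (mem_filter.1 h1).2.eq_of_root_eq hm0 (mem_filter.1 h1').2 h2 h2' h
  · intro v hv
    obtain ⟨x, h1, h2, h3⟩ := exists_isTreeTuple_of_paMinConn hm hξ (mem_filter.1 hv).2
    exact ⟨x, mem_filter.2 ⟨mem_filter.2 ⟨mem_univ _, h1⟩, h2⟩, h3⟩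

theorem IsTreeTuple.disjoint (hm : 0 < m) {x y : Fin (paik m k) → Fin t}
    (hx : IsTreeTuple m x) (hy : IsTreeTuple m y) {ξ : PAConfig t m} (hξx : ξ ∈ treeEvent m x)
    (hξy : ξ ∈ treeEvent m y) (hxy : x ≠ y) : Disjoint (univ.image x) (univ.image y) := by
  have key : ∀ a, ∀ (ha : a < paik m k) (b : Fin (paik m k)), x ⟨a, ha⟩ ≠ y b := by
    intro a
    induction a using Nat.strong_induction_on with
    | _ a ih =>
      intro ha b hab
      by_cases ha0 : a = 0
      · by_cases hb0 : b.val = 0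
        · subst ha0
          refine hxy (hx.eq_of_root_eq hm hy hξx hξy (hab.trans (congrArg y (Fin.ext hb0))))
        · have h1 := hx.root ⟨a, ha⟩ ha0
          have h2 := (hy.inner b hb0).2
          rw [hab] at h1
          omega
      · by_cases hb0 : b.val = 0
        · have h1 := hy.root b hb0
          have h2 := (hx.inner ⟨a, ha⟩ ha0).2
          rw [hab] at h2
          omega
        · have hle : (a - 1) / m ≤ a - 1 := Nat.div_le_self _ _
          have hlt : (a - 1) / m < paik m k := by omega
          have hedge : ξ (x ⟨(a - 1) / m, hlt⟩) ⟨(a - 1) % m, Nat.mod_lt _ hm⟩ = x ⟨a, ha⟩ := by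
            refine (hx.edge_iff hξx (_, _) _).2 ⟨⟨(a - 1) / m, hlt⟩, ⟨a, ha⟩, ?_, rfl, rfl⟩
            have := Nat.div_add_mod (a - 1) m
            simp only
            omega
          rw [hab] at hedge
          obtain ⟨c, -, -, h, -⟩ := (hy.edge_iff hξy (_, _) _).1 hedge
          exact ih _ (by omega) hlt c h
  rw [Finset.disjoint_left]
  intro u hu hu'
  obtain ⟨a, -, rfl⟩ := Finset.mem_image.1 hu
  obtain ⟨b, -, hb⟩ := Finset.mem_image.1 hu'
  exact key a.val a.isLt b hb.symm

/-- The probability that `x` is realized as a tree with no further edges into it. -/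
abbrev treeProb (δ : ℝ) (m : ℕ) {t n : ℕ} (x : Fin n → Fin t) : ℝ :=
  patternProb δ (univ.image x) (treeEdge (m := m) x)

theorem paExp_paMk (hm : 2 ≤ m) (δ : ℝ) :
    paExp t m δ (fun ξ => (paMk ξ k : ℝ)) = ∑ x ∈ treeTuples t m k, treeProb δ m x := by
  simp only [treeProb, patternProb, paExp]
  have h : ∀ x : Fin (paik m k) → Fin t, ∑ ξ ∈ treeEvent m x, paWeight t m δ ξ =
      ∑ ξ, if ξ ∈ treeEvent m x then paWeight t m δ ξ else 0 := fun x => by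
    rw [Finset.sum_ite_mem, Finset.univ_inter]
  rw [Finset.sum_congr rfl fun x _ => h x, Finset.sum_comm]
  refine Finset.sum_congr rfl fun ξ _ => ?_
  by_cases h0 : paWeight t m δ ξ = 0
  · simp [h0]
  · rw [paMk_eq_card hm (le_of_paWeight_ne_zero h0), ← Finset.sum_filter, Finset.sum_const,
      nsmul_eq_mul, mul_comm]

theorem paExp_paMk_sq (hm : 2 ≤ m) (δ : ℝ) :
    paExp t m δ (fun ξ => (paMk ξ k : ℝ) ^ 2) =
      ∑ x ∈ treeTuples t m k, ∑ y ∈ treeTuples t m k,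
        ∑ ξ ∈ treeEvent m x ∩ treeEvent m y, paWeight t m δ ξ := by
  simp only [paExp]
  have h : ∀ x y : Fin (paik m k) → Fin t,
      ∑ ξ ∈ treeEvent m x ∩ treeEvent m y, paWeight t m δ ξ =
      ∑ ξ, if ξ ∈ treeEvent m x ∩ treeEvent m y then paWeight t m δ ξ else 0 := fun x y => by
    rw [Finset.sum_ite_mem, Finset.univ_inter]
  simp only [h]
  simp only [Finset.sum_comm (t := (univ : Finset (PAConfig t m)))]
  refine Finset.sum_congr rfl fun ξ _ => ?_
  by_cases h0 : paWeight t m δ ξ = 0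
  · simp [h0]
  · rw [paMk_eq_card hm (le_of_paWeight_ne_zero h0), sq, Finset.card_filter]
    push_cast
    rw [Finset.sum_mul_sum, Finset.mul_sum]
    refine Finset.sum_congr rfl fun x _ => ?_
    rw [Finset.mul_sum]
    refine Finset.sum_congr rfl fun y _ => ?_
    by_cases h1 : ξ ∈ treeEvent m x <;> by_cases h2 : ξ ∈ treeEvent m y <;> simp [h1, h2]

theorem paExp_paMk_sq_le (hm : 2 ≤ m) {δ : ℝ} (hδ₁ : -(m : ℝ) < δ) (hδ₂ : δ < 0) (t k : ℕ) :
    paExp t m δ (fun ξ => (paMk ξ k : ℝ) ^ 2) ≤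
      Real.exp (32 * (m : ℝ) * (paik m k : ℝ) ^ 2 / t) *
          paExp t m δ (fun ξ => (paMk ξ k : ℝ)) ^ 2 +
        paExp t m δ (fun ξ => (paMk ξ k : ℝ)) := by
  have hm0 : 0 < m := by omega
  have hm1 : (1 : ℝ) ≤ m := by exact_mod_cast hm0
  rw [paExp_paMk_sq hm, paExp_paMk hm, sq (∑ x ∈ treeTuples t m k, treeProb δ m x)]
  set C := Real.exp (32 * (m : ℝ) * (paik m k : ℝ) ^ 2 / t) with hC
  have hC0 : 0 ≤ C := (Real.exp_pos _).le
  have hpair : ∀ x ∈ treeTuples t m k, ∀ y ∈ treeTuples t m k,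
      ∑ ξ ∈ treeEvent m x ∩ treeEvent m y, paWeight t m δ ξ ≤
        C * (treeProb δ m x * treeProb δ m y) + if x = y then treeProb δ m x else 0 := by
    intro x hx y hy
    have hx := (mem_filter.1 hx).2
    have hy := (mem_filter.1 hy).2
    have hnn : 0 ≤ C * (treeProb δ m x * treeProb δ m y) :=
      mul_nonneg hC0 (mul_nonneg (patternProb_nonneg hm0 hδ₁) (patternProb_nonneg hm0 hδ₁))
    by_cases hxy : x = y
    · subst hxy
      rw [Finset.inter_self, if_pos rfl]
      exact le_add_of_nonneg_left hnn
    rw [if_neg hxy, add_zero]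
    rcases (treeEvent m x ∩ treeEvent m y).eq_empty_or_nonempty with h | ⟨ξ, hξ⟩
    · rw [h, Finset.sum_empty]; exact hnn
    obtain ⟨h1, h2⟩ := Finset.mem_inter.1 hξ
    have hd := hx.disjoint hm0 hy h1 h2 hxy
    rw [treeEvent, treeEvent, patternEvent_inter hx.isPattern hy.isPattern hd]
    refine (patternProb_sup_le hx.isPattern hy.isPattern hd hm hδ₁ hδ₂
      (n := paik m k) ?_ ?_ hx.source_low hy.source_low).trans ?_
    · rw [Finset.card_image_of_injective _ hx.injective, Finset.card_univ, Fintype.card_fin]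
    · rw [Finset.card_image_of_injective _ hy.injective, Finset.card_univ, Fintype.card_fin]
    · refine mul_le_mul_of_nonneg_right (Real.exp_le_exp.2 ?_)
        (mul_nonneg (patternProb_nonneg hm0 hδ₁) (patternProb_nonneg hm0 hδ₁))
      gcongr
      linarith
  refine (Finset.sum_le_sum fun x hx => Finset.sum_le_sum (hpair x hx)).trans ?_
  simp only [Finset.sum_add_distrib, ← Finset.mul_sum]
  rw [Finset.sum_mul]
  refine add_le_add le_rfl (Finset.sum_le_sum fun x hx => ?_)
  rw [Finset.sum_ite_eq, if_pos hx]

end MinimallyConnected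

section LowerBound

variable {t m : ℕ}

theorem one_sub_patternNum_div_ge {n : ℕ} {x : Fin n → Fin t} {δ : ℝ} (hm : 2 ≤ m)
    (hδ₁ : -(m : ℝ) < δ) (hδ₂ : δ < 0) (hx : IsTreeTuple m x) (ht : 8 ≤ t) (hn : 8 * n ≤ t)
    (e : Fin t × Fin m) :
    Real.exp (-(24 * n / t)) ≤
      1 - (∑ u ∈ univ.image x, patternNum δ (treeEdge x) e u) / paNorm δ e := by
  have hm0 : 0 < m := by omega
  have hm2 : (2 : ℝ) ≤ m := by exact_mod_cast hm
  have htR : (0 : ℝ) < t := by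
    have : 0 < t := by omega
    exact_mod_cast this
  have hc := paNorm_pos hm0 hδ₁ e
  have hw1 := sum_patternNum_le (V := univ.image x) (R := treeEdge x) hm0 hδ₁ e
  set N := ((univ.image x).filter fun u => u ≤ e.1).card with hN
  set w := ∑ u ∈ univ.image x, patternNum δ (treeEdge x) e u with hw
  have hw0 : 0 ≤ w := Finset.sum_nonneg fun u _ => patternNum_nonneg hm0 hδ₁ e u
  by_cases hs : e.1.val < t / 4
  · have hN0 : N = 0 := by
      refine Finset.card_eq_zero.2 (Finset.filter_eq_empty_iff.2 fun u hu hle => ?_)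
      obtain ⟨a, -, rfl⟩ := Finset.mem_image.1 hu
      have hle : (x a).val ≤ e.1.val := hle
      by_cases ha : a.val = 0
      · have := hx.root a ha
        omega
      · have := (hx.inner a ha).1
        omega
    rw [hN0, Nat.cast_zero, zero_mul] at hw1
    rw [le_antisymm hw1 hw0, zero_div, sub_zero]
    exact Real.exp_le_one_iff.2 (neg_nonpos.2 (by positivity))
  · have hst : (t : ℝ) ≤ 8 * e.1.val := by
      have : t ≤ 8 * e.1.val := by omega
      exact_mod_cast this
    have hnt : (8 : ℝ) * n ≤ t := by exact_mod_cast hn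
    have hs0 : (0 : ℝ) < e.1.val := by linarith
    have hNn : (N : ℝ) ≤ n := by
      have : N ≤ n := (Finset.card_filter_le _ _).trans (Finset.card_image_le.trans (by simp))
      exact_mod_cast this
    have hcge := paNorm_ge hm0 hδ₁ e
    have hxn : w / paNorm δ e ≤ 6 * n / t := by
      rw [div_le_div_iff₀ hc htR]
      have h1 : w ≤ n * (m + 1 + δ) :=
        hw1.trans (mul_le_mul_of_nonneg_right hNn (by linarith))
      have h2 : (m : ℝ) + 1 + δ ≤ 3 / 4 * (2 * m + δ) := by linarith
      have hn0 : (0 : ℝ) ≤ n := Nat.cast_nonneg _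
      have hmd : 0 ≤ 2 * (m : ℝ) + δ := by linarith
      calc w * t ≤ n * (3 / 4 * (2 * m + δ)) * (8 * e.1.val) := by
            gcongr
            exact h1.trans (by gcongr)
        _ = 6 * n * (e.1.val * (2 * m + δ)) := by ring
        _ ≤ 6 * n * paNorm δ e := by gcongr
    have h34 : 6 * (n : ℝ) / t ≤ 3 / 4 := by
      rw [div_le_iff₀ htR]; linarith
    refine le_trans (Real.exp_le_exp.2 ?_)
      (exp_neg_four_mul_le (div_nonneg hw0 hc.le) (hxn.trans h34))
    rw [neg_le_neg_iff]
    calc 4 * (w / paNorm δ e) ≤ 4 * (6 * n / t) := by gcongr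
      _ = 24 * n / t := by ring

theorem IsTreeTuple.le_treeProb {n : ℕ} {x : Fin n → Fin t} {δ : ℝ} (hm : 2 ≤ m)
    (hδ₁ : -(m : ℝ) < δ) (hδ₂ : δ < 0) (hx : IsTreeTuple m x) (ht : 8 ≤ t) (hn : 8 * n ≤ t) :
    ((m + δ) / (2 * m * t)) ^ (n - 1) * Real.exp (-(24 * m * n)) ≤ treeProb δ m x := by
  have hm0 : 0 < m := by omega
  have hm2 : (2 : ℝ) ≤ m := by exact_mod_cast hm
  have htR : (0 : ℝ) < t := by
    have : 0 < t := by omega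
    exact_mod_cast this
  have hmd : 0 < (m : ℝ) + δ := by linarith
  set r := (m + δ) / (2 * m * t) with hr
  have hr0 : 0 < r := by positivity
  have hfac : ∀ e : Fin t × Fin m,
      (if ∃ u, treeEdge x e u then r else 1) * Real.exp (-(24 * n / t)) ≤
        patternFactor δ (univ.image x) (treeEdge x) e := by
    intro e
    have hexp : Real.exp (-(24 * n / t)) ≤ 1 :=
      Real.exp_le_one_iff.2 (neg_nonpos.2 (by positivity))
    rw [patternFactor]
    split_ifs with h
    · refine (mul_le_of_le_one_right hr0.le hexp).trans ?_
      refine div_le_div_of_nonneg_left hmd.le (paNorm_pos hm0 hδ₁ e) ?_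
      rw [paNorm_eq hm0]
      have h1 : (e.1.val : ℝ) + 1 ≤ t := by exact_mod_cast e.1.isLt
      have h2 : (e.2.val : ℝ) + 1 ≤ m := by exact_mod_cast e.2.isLt
      have h3 : (e.1.val : ℝ) * δ ≤ 0 := mul_nonpos_of_nonneg_of_nonpos (by positivity) hδ₂.le
      have h4 : ((e.2.val : ℝ) + 1) * δ / m ≤ 0 :=
        div_nonpos_of_nonpos_of_nonneg
          (mul_nonpos_of_nonneg_of_nonpos (by positivity) hδ₂.le) (by positivity)
      have h5 : (m : ℝ) * (e.1.val + 1) ≤ m * t := by gcongr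
      linarith
    · rw [one_mul]
      exact one_sub_patternNum_div_ge hm hδ₁ hδ₂ hx ht hn e
  rw [treeProb, hx.isPattern.patternProb_eq hm0 hδ₁]
  refine le_trans (le_of_eq ?_) (Finset.prod_le_prod (fun e _ => ?_) fun e _ => hfac e)
  · rw [Finset.prod_mul_distrib, Finset.prod_ite, Finset.prod_const, Finset.prod_const_one,
      mul_one, hx.card_edges hm0, Finset.prod_const, ← Real.exp_nat_mul]
    congr 2
    simp only [card_univ, Fintype.card_prod, Fintype.card_fin]
    push_cast
    field_simp
  · split_ifs <;> positivity

end LowerBound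

section Counting

variable {t m : ℕ}

theorem card_filter_fin_Ico {a b : ℕ} (hb : b ≤ t) :
    (univ.filter fun v : Fin t => a ≤ v.val ∧ v.val < b).card = b - a := by
  have h : ∀ n ∈ Finset.Ico a b, n < t := fun n hn => (Finset.mem_Ico.1 hn).2.trans_le hb
  rw [← Nat.card_Ico, ← Finset.card_attachFin _ h]
  congr 1
  ext v
  rw [mem_filter, Finset.mem_attachFin, Finset.mem_Ico]
  exact ⟨fun h => h.2, fun h => ⟨mem_univ _, h⟩⟩

theorem isTreeTuple_of_blocks {n b : ℕ} (hm : 0 < m) (ht : 4 ≤ t)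
    (hb : t / 4 + n * b ≤ t / 2) {x : Fin (n + 1) → Fin t} (hroot : t / 2 ≤ (x 0).val)
    (hinner : ∀ a : Fin n, t / 4 + (n - 1 - a.val) * b ≤ (x a.succ).val ∧
      (x a.succ).val < t / 4 + (n - a.val) * b) : IsTreeTuple m x := by
  have hlow : ∀ a : Fin n, t / 4 ≤ (x a.succ).val := fun a => by
    have := (hinner a).1
    omega
  have hhigh : ∀ a : Fin n, (x a.succ).val < t / 2 := fun a => by
    have h1 := (hinner a).2
    have h2 : (n - a.val) * b ≤ n * b := Nat.mul_le_mul_right _ (Nat.sub_le _ _)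
    omega
  have hanti : StrictAnti x := by
    intro a c hac
    rw [Fin.lt_def]
    obtain ⟨c, rfl⟩ := Fin.exists_succ_eq.2 (Fin.ne_zero_of_lt hac)
    induction a using Fin.cases with
    | zero => exact (hhigh c).trans_le hroot
    | succ a =>
      have hac : a.val < c.val := Fin.succ_lt_succ_iff.1 hac
      have h1 := (hinner c).2
      have h2 := (hinner a).1
      have h3 : (n - c.val) * b ≤ (n - 1 - a.val) * b := Nat.mul_le_mul_right _ (by omega)
      omega
  refine ⟨hanti.injective, fun a => ?_, fun a ha => ?_, fun a ha => ?_, fun a c j h => ?_⟩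
  · induction a using Fin.cases with
    | zero => omega
    | succ a => have := hlow a; omega
  · rw [show a = 0 from Fin.ext ha]; exact hroot
  · obtain ⟨a, rfl⟩ := Fin.exists_succ_eq.2 fun h : a = 0 => ha (by rw [h]; rfl)
    exact ⟨hlow a, hhigh a⟩
  · refine hanti ?_
    rw [Fin.lt_def]
    have := Nat.le_mul_of_pos_left a.val hm
    omega

theorem card_isTreeTuple_ge {n b : ℕ} (hm : 0 < m) (ht : 4 ≤ t)
    (hb : t / 4 + n * b ≤ t / 2) :
    (t - t / 2) * b ^ n ≤ (univ.filter fun x : Fin (n + 1) → Fin t => IsTreeTuple m x).card := by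
  set B : Fin (n + 1) → Finset (Fin t) := Fin.cons
    (univ.filter fun v => t / 2 ≤ v.val ∧ v.val < t)
    (fun a : Fin n => univ.filter fun v =>
      t / 4 + (n - 1 - a.val) * b ≤ v.val ∧ v.val < t / 4 + (n - a.val) * b) with hB
  have hcard : (Fintype.piFinset B).card = (t - t / 2) * b ^ n := by
    rw [Fintype.card_piFinset, Fin.prod_univ_succ]
    simp only [hB, Fin.cons_zero, Fin.cons_succ]
    rw [card_filter_fin_Ico le_rfl]
    congr 1
    rw [Finset.prod_eq_pow_card (b := b), card_univ, Fintype.card_fin]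
    intro a _
    have h2 : (n - a.val) * b ≤ n * b := Nat.mul_le_mul_right _ (Nat.sub_le _ _)
    rw [card_filter_fin_Ico (by omega)]
    have h3 : (n - a.val) * b = (n - 1 - a.val) * b + b := by
      rw [← Nat.succ_mul]
      congr 1
      have := a.isLt
      omega
    omega
  rw [← hcard]
  refine Finset.card_le_card fun x hx => ?_
  rw [Fintype.mem_piFinset] at hx
  rw [mem_filter]
  refine ⟨mem_univ _, isTreeTuple_of_blocks hm ht hb ?_ fun a => ?_⟩
  · have h := hx 0
    rw [hB, Fin.cons_zero, mem_filter] at h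
    exact h.2.1
  · have h := hx a.succ
    rw [hB, Fin.cons_succ, mem_filter] at h
    exact h.2

theorem le_paExp_paMk {δ : ℝ} (hm : 2 ≤ m) (hδ₁ : -(m : ℝ) < δ) (hδ₂ : δ < 0) {k : ℕ}
    (ht : 8 ≤ t) (hn : 8 * paik m k ≤ t) :
    (t : ℝ) / 2 * Real.exp (-(paik m k *
      (Real.log (16 * m / (m + δ) * paik m k) + 24 * m))) ≤
        paExp t m δ (fun ξ => (paMk ξ k : ℝ)) := by
  have hm0 : 0 < m := by omega
  have hmR : (0 : ℝ) < m := by exact_mod_cast hm0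
  have hmd : 0 < (m : ℝ) + δ := by linarith
  have htR : (0 : ℝ) < t := by
    have : 0 < t := by omega
    exact_mod_cast this
  rw [paExp_paMk hm]
  set r := (m + δ) / (2 * m * t) with hr
  have hr0 : 0 < r := by positivity
  have h1 : ∀ x ∈ treeTuples t m k,
      r ^ (paik m k - 1) * Real.exp (-(24 * m * paik m k)) ≤ treeProb δ m x :=
    fun x hx => (mem_filter.1 hx).2.le_treeProb hm hδ₁ hδ₂ ht hn
  refine le_trans ?_ (Finset.card_nsmul_le_sum _ _ _ h1)
  rw [nsmul_eq_mul]
  have hcard : ∀ b : ℕ, t / 4 + (paik m k - 1) * b ≤ t / 2 →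
      (t - t / 2) * b ^ (paik m k - 1) ≤ (treeTuples t m k).card := by
    unfold treeTuples
    obtain ⟨n, hn⟩ : ∃ n, paik m k = n + 1 := ⟨paik m k - 1, by have := paik_pos m k; omega⟩
    rw [hn]
    exact fun b hb => card_isTreeTuple_ge hm0 (by omega) hb
  have hn0 := paik_pos m k
  set n := paik m k with hndef
  set b := (t / 2 - t / 4) / n with hb
  have hbn : n * b ≤ t / 2 - t / 4 := Nat.mul_div_le _ _
  have hbt : t ≤ 8 * n * b := by
    have h := Nat.lt_mul_div_succ (t / 2 - t / 4) hn0
    rw [← hb, mul_add, mul_one] at h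
    rw [mul_assoc]
    omega
  have hfit : t / 4 + (n - 1) * b ≤ t / 2 := by
    have : (n - 1) * b ≤ n * b := Nat.mul_le_mul_right _ (Nat.sub_le _ _)
    omega
  have hc : (t - t / 2) * b ^ (n - 1) ≤ (treeTuples t m k).card := hcard b hfit
  have hnR : (1 : ℝ) ≤ n := by exact_mod_cast hn0
  set K := 16 * m / (m + δ) * n with hK
  have hK1 : 1 ≤ K := by
    have : (1 : ℝ) ≤ 16 * m / (m + δ) := by
      rw [le_div_iff₀ hmd]; linarith
    exact one_le_mul_of_one_le_of_one_le this hnR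
  have hK0 : 0 < K := by linarith
  have hbr : K⁻¹ ≤ b * r := by
    have hbt' : (t : ℝ) ≤ 8 * n * b := by exact_mod_cast hbt
    have h2 : b * r = b * n * 8 / t * K⁻¹ := by
      rw [hr, hK]
      field_simp
      ring
    rw [h2]
    refine le_mul_of_one_le_left (inv_nonneg.2 hK0.le) ?_
    rw [le_div_iff₀ htR]
    linarith
  have hexp : Real.exp (-(n * (Real.log K + 24 * m))) =
      K⁻¹ ^ n * Real.exp (-(24 * m * n)) := by
    rw [← Real.exp_log (inv_pos.2 hK0), ← Real.exp_nat_mul, ← Real.exp_add, Real.log_inv]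
    congr 1
    ring
  have hhalf : (t : ℝ) / 2 ≤ (t - t / 2 : ℕ) := by
    rw [div_le_iff₀ two_pos]
    have : t ≤ (t - t / 2) * 2 := by omega
    exact_mod_cast this
  calc (t : ℝ) / 2 * Real.exp (-(n * (Real.log K + 24 * m)))
      = t / 2 * K⁻¹ ^ n * Real.exp (-(24 * m * n)) := by
        rw [hexp, ← mul_assoc]
    _ ≤ (t - t / 2 : ℕ) * (b * r) ^ (n - 1) * Real.exp (-(24 * m * n)) := by
        gcongr ?_ * ?_ * _
        calc K⁻¹ ^ n ≤ K⁻¹ ^ (n - 1) :=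
              pow_le_pow_of_le_one (inv_nonneg.2 hK0.le) (inv_le_one_of_one_le₀ hK1)
                (Nat.sub_le _ _)
          _ ≤ (b * r) ^ (n - 1) := by gcongr
    _ = ((t - t / 2) * b ^ (n - 1) : ℕ) * (r ^ (n - 1) * Real.exp (-(24 * m * n))) := by
        push_cast
        rw [mul_pow]
        ring
    _ ≤ (treeTuples t m k).card * (r ^ (n - 1) * Real.exp (-(24 * m * n))) := by
        gcongr

end Counting

section Asymptotics

variable {m : ℕ}

theorem paik_lt_pow (hm : 2 ≤ m) (k : ℕ) : paik m k < m ^ (k + 1) :=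
  Nat.geomSum_lt hm fun _ hl => Finset.mem_range.1 hl

theorem exists_paik_ktMinus_le (hm : 2 ≤ m) {ε : ℝ} (hε : 0 < ε) :
    ∃ η : ℝ, 0 < η ∧ η < 1 ∧ ∀ t : ℕ, 1 ≤ Real.log t →
      (paik m (ktMinus ε m t) : ℝ) ≤ m ^ 2 * Real.log t ^ η := by
  refine ⟨1 - min ε (1 / 2), ?_, ?_, fun t ht => ?_⟩
  · have := min_le_right ε (1 / 2)
    linarith
  · have : 0 < min ε (1 / 2) := lt_min hε (by norm_num)
    linarith
  set η := 1 - min ε (1 / 2) with hη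
  have hη0 : 0 ≤ η := by
    have := min_le_right ε (1 / 2)
    linarith
  have hηε : 1 - ε ≤ η := by
    have := min_le_left ε (1 / 2)
    linarith
  set L := Real.log t with hL
  have hL0 : 0 < L := by linarith
  have hlm : 0 < Real.log m := Real.log_pos (by exact_mod_cast hm)
  have hll : 0 ≤ Real.log L := Real.log_nonneg ht
  have hmR : (0 : ℝ) < m := by
    have : 0 < m := by omega
    exact_mod_cast this
  set z := η * Real.log L / Real.log m with hz
  have hz0 : 0 ≤ z := by positivity
  set k := ktMinus ε m t with hk
  have hkz : (k : ℝ) ≤ z + 1 := by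
    have h1 : (k : ℤ) ≤ max (round ((1 - ε) * Real.log L / Real.log m)) 0 :=
      (Int.toNat_eq_max _).le
    have h2 : (k : ℝ) ≤ max (round ((1 - ε) * Real.log L / Real.log m) : ℝ) 0 := by
      exact_mod_cast h1
    refine h2.trans (max_le ?_ (by linarith))
    have h3 := abs_le.1 (abs_sub_round ((1 - ε) * Real.log L / Real.log m))
    have h4 : (1 - ε) * Real.log L / Real.log m ≤ z := by rw [hz]; gcongr
    linarith [h3.1]
  calc (paik m k : ℝ) ≤ (m : ℝ) ^ (k + 1) := by exact_mod_cast (paik_lt_pow hm k).le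
    _ = Real.exp ((k + 1) * Real.log m) := by
        rw [← Real.rpow_natCast, Real.rpow_def_of_pos hmR]
        push_cast
        ring_nf
    _ ≤ Real.exp ((z + 1 + 1) * Real.log m) := by gcongr
    _ = m ^ 2 * L ^ η := by
        have h : (z + 1 + 1) * Real.log m = Real.log L * η + 2 * Real.log m := by
          rw [hz]
          field_simp
          ring
        rw [h, Real.exp_add, ← Real.rpow_def_of_pos hL0, mul_comm]
        congr 1
        rw [mul_comm, Real.exp_mul, Real.exp_log hmR]
        norm_cast

theorem tendsto_log_natCast_atTop : Tendsto (fun t : ℕ => Real.log t) atTop atTop :=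
  Real.tendsto_log_atTop.comp tendsto_natCast_atTop_atTop

theorem eventually_log_pow_le (n : ℕ) {a : ℝ} (ha : 0 < a) :
    ∀ᶠ t : ℕ in atTop, Real.log t ^ n ≤ a * t := by
  have h := (Real.isLittleO_pow_log_id_atTop (n := n)).def ha
  filter_upwards [tendsto_natCast_atTop_atTop.eventually h] with t ht
  simp only [id, Real.norm_eq_abs, Nat.abs_cast] at ht
  exact (le_abs_self _).trans ht

theorem eventually_paik_sq_div_le (hm : 2 ≤ m) {ε : ℝ} (hε : 0 < ε) {a : ℝ} (ha : 0 < a) :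
    ∀ᶠ t : ℕ in atTop, (paik m (ktMinus ε m t) : ℝ) ^ 2 / t ≤ a := by
  obtain ⟨η, -, hη1, hη⟩ := exists_paik_ktMinus_le hm hε
  have hm4 : (0 : ℝ) < m ^ 4 := by
    have : 0 < m ^ 4 := by positivity
    exact_mod_cast this
  filter_upwards [tendsto_log_natCast_atTop.eventually_ge_atTop 1,
    eventually_log_pow_le 2 (div_pos ha hm4), eventually_gt_atTop 0] with t h1 h2 h3
  have htR : (0 : ℝ) < t := by exact_mod_cast h3
  rw [div_le_iff₀ htR]
  have h4 : Real.log t ^ η ≤ Real.log t := by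
    simpa using Real.rpow_le_rpow_of_exponent_le h1 hη1.le
  calc (paik m (ktMinus ε m t) : ℝ) ^ 2 ≤ (m ^ 2 * Real.log t) ^ 2 := by
        gcongr
        exact (hη t h1).trans (by gcongr)
    _ = m ^ 4 * Real.log t ^ 2 := by ring
    _ ≤ m ^ 4 * (a / m ^ 4 * t) := by gcongr
    _ = a * t := by field_simp

theorem eventually_paik_mul_log_le (hm : 2 ≤ m) {ε : ℝ} (hε : 0 < ε) {K : ℝ} (hK : 1 ≤ K)
    (A : ℝ) :
    ∀ᶠ t : ℕ in atTop, (paik m (ktMinus ε m t) : ℝ) *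
      (Real.log (K * paik m (ktMinus ε m t)) + A) ≤ Real.log t / 2 := by
  obtain ⟨η, hη0, hη1, hη⟩ := exists_paik_ktMinus_le hm hε
  have hm0 : (0 : ℝ) < m := by
    have : 0 < m := by omega
    exact_mod_cast this
  set C : ℝ := m ^ 2 with hC
  have hC0 : 0 < C := by positivity
  have hlo : (fun L : ℝ => (Real.log (K * C) + |A|) + Real.log L) =o[atTop]
      fun L => L ^ (1 - η) := by
    refine Asymptotics.IsLittleO.add (Asymptotics.isLittleO_const_left.2 (Or.inr ?_))
      (isLittleO_log_rpow_atTop (by linarith))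
    exact tendsto_norm_atTop_atTop.comp (tendsto_rpow_atTop (by linarith))
  have hlo := hlo.def (show (0 : ℝ) < 1 / (2 * C) by positivity)
  filter_upwards [tendsto_log_natCast_atTop.eventually_ge_atTop 1,
    tendsto_log_natCast_atTop.eventually hlo] with t h1 h2
  set L := Real.log t
  have hL0 : 0 < L := by linarith
  set n := paik m (ktMinus ε m t)
  have hn0 : 0 < n := paik_pos m _
  have hnR : (0 : ℝ) < n := by exact_mod_cast hn0
  have hK0 : 0 < K := by linarith
  have hnC : (n : ℝ) ≤ C * L ^ η := hη t h1
  have hnorm : ‖L ^ (1 - η)‖ = L ^ (1 - η) := by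
    rw [Real.norm_eq_abs, abs_of_nonneg (by positivity)]
  rw [hnorm] at h2
  have hlog : Real.log (K * n) + A ≤ 1 / (2 * C) * L ^ (1 - η) := by
    refine le_trans ?_ ((le_abs_self _).trans h2)
    have h3 : Real.log (K * n) ≤ Real.log (K * C) + Real.log L := by
      rw [← Real.log_mul (by positivity) (by positivity)]
      refine Real.log_le_log (by positivity) ?_
      have h4 : L ^ η ≤ L := by simpa using Real.rpow_le_rpow_of_exponent_le h1 hη1.le
      calc K * n ≤ K * (C * L) := by
            gcongr
            exact hnC.trans (by gcongr)
        _ = K * C * L := by ring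
    linarith [le_abs_self A]
  calc (n : ℝ) * (Real.log (K * n) + A) ≤ n * (1 / (2 * C) * L ^ (1 - η)) := by gcongr
    _ ≤ C * L ^ η * (1 / (2 * C) * L ^ (1 - η)) := by gcongr
    _ = L ^ η * L ^ (1 - η) / 2 := by field_simp
    _ = L / 2 := by rw [← Real.rpow_add hL0, add_sub_cancel, Real.rpow_one]

theorem tendsto_paExp_paMk_ktMinus (hm : 2 ≤ m) {δ : ℝ} (hδ₁ : -(m : ℝ) < δ) (hδ₂ : δ < 0)
    {ε : ℝ} (hε : 0 < ε) :
    Tendsto (fun t : ℕ => paExp t m δ (fun ξ => (paMk ξ (ktMinus ε m t) : ℝ))) atTop atTop := by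
  have hmR : (0 : ℝ) < m := by
    have : 0 < m := by omega
    exact_mod_cast this
  have hmd : 0 < (m : ℝ) + δ := by linarith
  have hK : 1 ≤ 16 * (m : ℝ) / (m + δ) := by
    rw [le_div_iff₀ hmd]; linarith
  have hlim : Tendsto (fun t : ℕ => 1 / 2 * Real.exp (Real.log t / 2)) atTop atTop :=
    (Real.tendsto_exp_atTop.comp
      (tendsto_log_natCast_atTop.atTop_div_const two_pos)).const_mul_atTop (by norm_num)
  refine tendsto_atTop_mono' _ ?_ hlim
  filter_upwards [eventually_paik_mul_log_le hm hε hK (24 * m),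
    eventually_paik_sq_div_le hm hε (show (0 : ℝ) < 1 / 8 by norm_num),
    eventually_ge_atTop 8] with t h1 h2 h3
  have htR : (0 : ℝ) < t := by
    have : 0 < t := by omega
    exact_mod_cast this
  have hn : 8 * paik m (ktMinus ε m t) ≤ t := by
    rw [div_le_iff₀ htR] at h2
    have h5 : 8 * paik m (ktMinus ε m t) ^ 2 ≤ t := by
      have : 8 * (paik m (ktMinus ε m t) : ℝ) ^ 2 ≤ t := by linarith
      exact_mod_cast this
    have h6 := Nat.le_self_pow two_ne_zero (paik m (ktMinus ε m t))
    omega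
  refine le_trans ?_ (le_paExp_paMk hm hδ₁ hδ₂ h3 hn)
  calc 1 / 2 * Real.exp (Real.log t / 2)
      = t / 2 * Real.exp (-(Real.log t / 2)) := by
        have h7 : Real.log t / 2 = Real.log t + -(Real.log t / 2) := by ring
        conv_lhs => rw [h7, Real.exp_add, Real.exp_log htR]
        ring
    _ ≤ _ := by gcongr

theorem eventually_paExp_paMk_sq_le (hm : 2 ≤ m) {δ : ℝ} (hδ₁ : -(m : ℝ) < δ) (hδ₂ : δ < 0)
    {ε : ℝ} (hε : 0 < ε) {c : ℝ} (hc : 1 < c) :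
    ∀ᶠ t : ℕ in atTop,
      paExp t m δ (fun ξ => (paMk ξ (ktMinus ε m t) : ℝ) ^ 2) ≤
        c * paExp t m δ (fun ξ => (paMk ξ (ktMinus ε m t) : ℝ)) ^ 2 := by
  have hmR : (0 : ℝ) < m := by
    have : 0 < m := by omega
    exact_mod_cast this
  have hθ : 0 < Real.log ((1 + c) / 2) := Real.log_pos (by linarith)
  filter_upwards [
    eventually_paik_sq_div_le hm hε (show 0 < Real.log ((1 + c) / 2) / (32 * m) by positivity),
    (tendsto_paExp_paMk_ktMinus hm hδ₁ hδ₂ hε).eventually_ge_atTop (2 / (c - 1))] with t h1 h2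
  have hc1 : 0 < c - 1 := by linarith
  refine (paExp_paMk_sq_le hm hδ₁ hδ₂ t _).trans ?_
  set E := paExp t m δ (fun ξ => (paMk ξ (ktMinus ε m t) : ℝ))
  have hE0 : 0 < E := lt_of_lt_of_le (by positivity) h2
  have hexp : Real.exp (32 * (m : ℝ) * (paik m (ktMinus ε m t) : ℝ) ^ 2 / t) ≤ (1 + c) / 2 := by
    rw [← Real.le_log_iff_exp_le (by linarith), mul_div_assoc]
    rwa [le_div_iff₀' (by positivity)] at h1
  rw [div_le_iff₀ hc1] at h2
  have h3 : 2 * E ≤ E * (c - 1) * E := by gcongr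
  calc _ ≤ (1 + c) / 2 * E ^ 2 + E := by gcongr
    _ ≤ c * E ^ 2 := by linarith

end Asymptotics

/-- **Second moment of the number of minimally connected vertices (Proposition 4.9).**
For `m ≥ 2` and `δ ∈ (-m, 0)`: for every `t` and `k`,
`E[M_k²] ≤ exp(32 m i_k²/t) E[M_k]² + E[M_k]` with `i_k = (m^{k+1}-1)/(m-1)`;
consequently, for `k = k_t^- = (1-ε) log log t / log m`,
`E[M_{k_t^-}²] ≤ (1 + o(1)) E[M_{k_t^-}]²` as `t → ∞`. -/
theorem pa_Mk_second_moment (m : ℕ) (hm : 2 ≤ m) (δ : ℝ) (hδ₁ : -(m : ℝ) < δ)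
    (hδ₂ : δ < 0) :
    (∀ t k : ℕ,
      paExp t m δ (fun ξ => (paMk ξ k : ℝ) ^ 2) ≤
        Real.exp (32 * (m : ℝ) * (paik m k : ℝ) ^ 2 / t) *
            paExp t m δ (fun ξ => (paMk ξ k : ℝ)) ^ 2 +
          paExp t m δ (fun ξ => (paMk ξ k : ℝ))) ∧
    (∀ ε : ℝ, 0 < ε → ∀ c : ℝ, 1 < c → ∀ᶠ t : ℕ in atTop,
      paExp t m δ (fun ξ => (paMk ξ (ktMinus ε m t) : ℝ) ^ 2) ≤
        c * paExp t m δ (fun ξ => (paMk ξ (ktMinus ε m t) : ℝ)) ^ 2) := by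
  exact ⟨paExp_paMk_sq_le hm hδ₁ hδ₂,
    fun _ hε _ hc => eventually_paExp_paMk_sq_le hm hδ₁ hδ₂ hε hc⟩
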